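/- arXiv:math/0409462 — 4 statements merged into one kernel-verified Lean document; each statement's English description precedes it below -/
import Mathlib

section
/- Let p0, p1, p2 ∈ R_{2,1} have no common zeros on P^1 × P^1, and write p_i = C_i(z,w) x^2 + D_i(z,w) xy + E_i(z,w) y^2 with C_i, D_i, E_i ∈ R_{0,1}. Define C^(1) := ((C1 x + D1 y) E2 − (C2 x + D2 y) E1, (C2 x + D2 y) E0 − (C0 x + D0 y) E2, (C0 x + D0 y) E1 − (C1 x + D1 y) E0) and C^(2) := (C1 (D2 x + E2 y) − C2 (D1 x + E1 y), C2 (D0 x + E0 y) − C0 (D2 x + E2 y), C0 (D1 x + E1 y) − C1 (D0 x + E0 y)). Then C^(1) and C^(2) are k-linearly independent elements of Syz(p)_{3,3}, and they span Syz(p)_{3,3} as a k-vector space. -/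
open MvPolynomial

noncomputable section

/-- The bigraded polynomial ring `R = k[x,y,z,w]`; variables `0,1,2,3` are `x,y,z,w`. -/
abbrev Rk (k : Type*) [Field k] := MvPolynomial (Fin 4) k

/-- The bigrading: `x, y` have degree `(1,0)`; `z, w` have degree `(0,1)`. -/
def bidegWt : Fin 4 → ℤ × ℤ := ![(1, 0), (1, 0), (0, 1), (0, 1)]

/-- `p` is bihomogeneous of bidegree `(m, n)` (with the convention that only the zero
polynomial is bihomogeneous of a bidegree with a negative coordinate). -/
def Bihom {k : Type*} [Field k] (p : Rk k) (m n : ℤ) : Prop :=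
  p.IsWeightedHomogeneous bidegWt (m, n)

/-- `p0, p1, p2` have no common zeros on `ℙ¹ × ℙ¹`. -/
def NoCommonZeros {k : Type*} [Field k] (p0 p1 p2 : Rk k) : Prop :=
  ∀ a b c d : k, (a, b) ≠ (0, 0) → (c, d) ≠ (0, 0) →
    eval ![a, b, c, d] p0 ≠ 0 ∨ eval ![a, b, c, d] p1 ≠ 0 ∨ eval ![a, b, c, d] p2 ≠ 0

/-- The map `(A0, A1, A2) ↦ A0 p0 + A1 p1 + A2 p2`, as a `k`-linear map on `R³`. -/
def syzMapk {k : Type*} [Field k] (p : Fin 3 → Rk k) : (Fin 3 → Rk k) →ₗ[k] Rk k :=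
  ∑ i : Fin 3, (LinearMap.mulRight k (p i)).comp (LinearMap.proj i)

/-- The bigraded piece `Syz(p)_{m,n}`: triples `(A0, A1, A2)` of bihomogeneous polynomials of
bidegree `(m-2, n-1)` with `A0 p0 + A1 p1 + A2 p2 = 0`, as a `k`-subspace of `R³`. -/
def SyzPiece {k : Type*} [Field k] (p : Fin 3 → Rk k) (m n : ℤ) :
    Submodule k (Fin 3 → Rk k) :=
  (Submodule.pi Set.univ fun _ => weightedHomogeneousSubmodule k bidegWt (m - 2, n - 1)) ⊓
    LinearMap.ker (syzMapk p)

/-- The syzygy module `Syz(p)`, as an `R`-submodule of `R³`. -/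
def Syz {k : Type*} [Field k] (p : Fin 3 → Rk k) : Submodule (Rk k) (Fin 3 → Rk k) :=
  LinearMap.ker (∑ i : Fin 3, (LinearMap.mulRight (Rk k) (p i)).comp (LinearMap.proj i))

/-- The Koszul submodule of `R³`: the `R`-submodule generated by the three Koszul syzygies
`(p1, −p0, 0)`, `(p2, 0, −p0)`, `(0, p2, −p1)`. -/
def KoszulSub {k : Type*} [Field k] (p0 p1 p2 : Rk k) : Submodule (Rk k) (Fin 3 → Rk k) :=
  Submodule.span (Rk k) {![p1, -p0, 0], ![p2, 0, -p0], ![0, p2, -p1]}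

/-- `p0, p1, p2 ∈ R_{2,1}` are generic: only finitely many points `[a0 : a1 : a2]` of `ℙ²(k)`
are such that `a0 p0 + a1 p1 + a2 p2` factors as `q · l` with `q ∈ R_{2,0}`, `l ∈ R_{0,1}`. -/
def BidegGeneric {k : Type*} [Field k] (p0 p1 p2 : Rk k) : Prop :=
  {P : Projectivization k (Fin 3 → k) |
    ∃ q l : Rk k, Bihom q 2 0 ∧ Bihom l 0 1 ∧
      P.rep 0 • p0 + P.rep 1 • p1 + P.rep 2 • p2 = q * l}.Finite

section

open Matrix

theorem eq_smul_of_cross_eq_zero {k : Type*} [Field k] {u v : Fin 3 → k} (hu : u ≠ 0)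
    (h : crossProduct u v = 0) : ∃ r : k, v = r • u := by
  have h0 := congrFun h 0
  have h1 := congrFun h 1
  have h2 := congrFun h 2
  simp only [cross_apply, cons_val, Pi.zero_apply] at h0 h1 h2
  obtain ⟨i, hi⟩ := Function.ne_iff.mp hu
  simp only [Pi.zero_apply] at hi
  refine ⟨v i / u i, ?_⟩
  ext j
  simp only [Pi.smul_apply, smul_eq_mul]
  rw [div_mul_eq_mul_div, eq_div_iff hi]
  fin_cases i <;> fin_cases j <;> simp only [Fin.zero_eta, Fin.mk_one, Fin.reduceFinMk] <;> grind

/-- The binary quadratic `x² c + x y d + y² e` with vector coefficients has no nontrivial zero. -/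
def NoQuadraticZero {k : Type*} [Field k] (c d e : Fin 3 → k) : Prop :=
  ∀ x y : k, x ≠ 0 ∨ y ≠ 0 → x ^ 2 • c + (x * y) • d + y ^ 2 • e ≠ 0

namespace NoQuadraticZero

variable {k : Type*} [Field k] {c d e : Fin 3 → k}

theorem left_ne_zero (h : NoQuadraticZero c d e) : c ≠ 0 := by
  simpa using h 1 0 (by simp)

theorem right_ne_zero (h : NoQuadraticZero c d e) : e ≠ 0 := by
  simpa using h 0 1 (by simp)

theorem not_proportional [IsAlgClosed k] {r s : k}
    (h : NoQuadraticZero (r • e) (s • e) e) : False := by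
  obtain ⟨y, hy⟩ := IsAlgClosed.exists_root
    (Polynomial.X ^ 2 + Polynomial.C s * Polynomial.X + Polynomial.C r : Polynomial k) (by
      have : (Polynomial.X ^ 2 + Polynomial.C s * Polynomial.X + Polynomial.C r :
        Polynomial k).degree = 2 := by compute_degree!
      rw [this]; norm_num)
  refine h 1 y (by simp) ?_
  have hroot : y ^ 2 + s * y + r = 0 := by simpa [Polynomial.IsRoot] using hy
  rw [smul_smul, smul_smul, ← add_smul, ← add_smul]
  convert zero_smul k e using 2
  linear_combination hroot

/-- The Sylvester-type matrix of a quadratic without zeros has trivial left kernel. -/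
theorem relation_trivial [IsAlgClosed k] (h : NoQuadraticZero c d e) {f : Fin 4 → k}
    (h₁ : f 0 • c + f 1 • d + f 2 • e = 0) (h₂ : f 1 • c + f 2 • d + f 3 • e = 0) : f = 0 := by
  have hc := h.left_ne_zero
  have he := h.right_ne_zero
  have e₁ : (f 0 * f 2 - f 1 ^ 2) • d + (f 0 * f 3 - f 1 * f 2) • e = 0 := by
    linear_combination (norm := module) (-f 1) • h₁ + f 0 • h₂
  have e₂ : (f 0 * f 2 - f 1 ^ 2) • c - (f 1 * f 3 - f 2 ^ 2) • e = 0 := by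
    linear_combination (norm := module) f 2 • h₁ - f 1 • h₂
  by_cases q₀ : f 0 * f 2 - f 1 ^ 2 = 0
  · have q₂ : f 1 * f 3 - f 2 ^ 2 = 0 := by simpa [q₀, he] using e₂
    have f₀ : f 0 = 0 := by
      by_contra hf
      refine h (f 0) (f 1) (Or.inl hf) ?_
      have : f 1 ^ 2 = f 0 * f 2 := by linear_combination -q₀
      rw [this]
      linear_combination (norm := module) f 0 • h₁
    have f₁ : f 1 = 0 := by simpa [f₀] using q₀
    have f₂ : f 2 = 0 := by simpa [f₁] using q₂
    have f₃ : f 3 = 0 := by simpa [f₁, f₂, he] using h₂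
    ext i
    fin_cases i <;> assumption
  · exfalso
    have hd : d = (-(f 0 * f 3 - f 1 * f 2) / (f 0 * f 2 - f 1 ^ 2)) • e := by
      rw [div_eq_inv_mul, mul_smul, eq_inv_smul_iff₀ q₀]
      linear_combination (norm := module) e₁
    have hc : c = ((f 1 * f 3 - f 2 ^ 2) / (f 0 * f 2 - f 1 ^ 2)) • e := by
      rw [div_eq_inv_mul, mul_smul, eq_inv_smul_iff₀ q₀]
      linear_combination (norm := module) e₂
    rw [hd, hc] at h
    exact h.not_proportional

theorem cross_independent [IsAlgClosed k] (h : NoQuadraticZero c d e) {r s : k}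
    (h₁ : r • crossProduct c e + s • crossProduct c d = 0)
    (h₂ : r • crossProduct d e + s • crossProduct c e = 0) : r = 0 ∧ s = 0 := by
  obtain ⟨u, hu⟩ := eq_smul_of_cross_eq_zero (v := r • e + s • d) h.left_ne_zero (by simpa using h₁)
  obtain ⟨v, hv⟩ := eq_smul_of_cross_eq_zero (v := r • d + s • c) h.right_ne_zero (by
    rw [← neg_eq_zero, cross_anticomm]; simpa using h₂)
  have := h.relation_trivial (f := ![u, -s, -r, v])
    (by simp; linear_combination (norm := module) -hu)
    (by simp; linear_combination (norm := module) -hv)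
  have t₁ := congrFun this 1
  have t₂ := congrFun this 2
  simp at t₁ t₂
  exact ⟨t₂, t₁⟩

/-- The map sending `(a, b)` to the coefficients of `(a x + b y) ⬝ (c x² + d x y + e y²)`. -/
def sylvester (c d e : Fin 3 → k) : (Fin 3 → k) × (Fin 3 → k) →ₗ[k] (Fin 4 → k) where
  toFun q := ![q.1 ⬝ᵥ c, q.1 ⬝ᵥ d + q.2 ⬝ᵥ c, q.1 ⬝ᵥ e + q.2 ⬝ᵥ d, q.2 ⬝ᵥ e]
  map_add' p q := by ext i; fin_cases i <;> simp [add_dotProduct] <;> ring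
  map_smul' r q := by ext i; fin_cases i <;> simp [mul_add]

theorem sylvester_surjective [IsAlgClosed k] (h : NoQuadraticZero c d e) :
    Function.Surjective (sylvester c d e) := by
  rw [← LinearMap.range_eq_top]
  by_contra hne
  obtain ⟨f, hf, hle⟩ := Submodule.exists_le_ker_of_lt_top _ (lt_top_iff_ne_top.mpr hne)
  have key (q) : f (sylvester c d e q) = 0 := hle ⟨q, rfl⟩
  have hsum (v : Fin 4 → k) : f v = ∑ i, v i * f (Pi.single i 1) := by
    conv_lhs => rw [← Finset.univ_sum_single v]
    simp only [map_sum]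
    refine Finset.sum_congr rfl fun i _ => ?_
    rw [← smul_eq_mul, ← map_smul, ← Pi.single_smul, smul_eq_mul, mul_one]
  have := h.relation_trivial (f := fun i => f (Pi.single i 1))
    (by
      ext j
      have := key (Pi.single j 1, 0)
      rw [hsum] at this
      simp [sylvester, Fin.sum_univ_four] at this
      simp; linear_combination this)
    (by
      ext j
      have := key (0, Pi.single j 1)
      rw [hsum] at this
      simp [sylvester, Fin.sum_univ_four] at this
      simp; linear_combination this)
  refine hf (LinearMap.ext fun v => ?_)
  rw [hsum]
  exact Finset.sum_eq_zero fun i _ => by rw [congrFun this i]; simp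

theorem exists_eq_cross [IsAlgClosed k] (h : NoQuadraticZero c d e) {a b : Fin 3 → k}
    (h₀ : a ⬝ᵥ c = 0) (h₁ : a ⬝ᵥ d + b ⬝ᵥ c = 0) (h₂ : a ⬝ᵥ e + b ⬝ᵥ d = 0) (h₃ : b ⬝ᵥ e = 0) :
    ∃ r s : k, a = r • crossProduct c e + s • crossProduct c d ∧
      b = r • crossProduct d e + s • crossProduct c e := by
  let u : (Fin 3 → k) × (Fin 3 → k) := (crossProduct c e, crossProduct d e)
  let v : (Fin 3 → k) × (Fin 3 → k) := (crossProduct c d, crossProduct c e)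
  have hli : LinearIndependent k ![u, v] := by
    rw [LinearIndependent.pair_iff]
    intro r s hrs
    exact h.cross_independent (congrArg Prod.fst hrs) (congrArg Prod.snd hrs)
  have hfin : Module.finrank k (LinearMap.ker (sylvester c d e)) = 2 := by
    have := LinearMap.finrank_range_add_finrank_ker (sylvester c d e)
    rw [LinearMap.range_eq_top.mpr h.sylvester_surjective] at this
    simp at this
    omega
  have hle : Submodule.span k (Set.range ![u, v]) ≤ LinearMap.ker (sylvester c d e) := by
    rw [Submodule.span_le]
    rintro _ ⟨i, rfl⟩
    fin_cases i <;> simp only [SetLike.mem_coe, LinearMap.mem_ker] <;> ext j <;> fin_cases j <;>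
      simp [u, v, sylvester, cross_apply, dotProduct, Fin.sum_univ_three] <;> ring
  have heq := Submodule.eq_of_le_of_finrank_eq hle (by
    rw [finrank_span_eq_card hli, hfin]; rfl)
  have hmem : (a, b) ∈ LinearMap.ker (sylvester c d e) := by
    rw [LinearMap.mem_ker]
    ext j
    fin_cases j <;> simp [sylvester, *]
  rw [← heq] at hmem
  simp only [range_cons, range_empty, Set.union_empty, Set.singleton_union] at hmem
  obtain ⟨r, s, hrs⟩ := Submodule.mem_span_pair.mp hmem
  exact ⟨r, s, (congrArg Prod.fst hrs).symm, (congrArg Prod.snd hrs).symm⟩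

end NoQuadraticZero

/-- A polynomial vector `W` that is pointwise a combination of two pointwise independent
polynomial vectors `U` and `V` lies in their span over the polynomial ring. -/
theorem exists_polynomial_combination {k ι : Type*} [Field k] [IsAlgClosed k]
    {U V W : ι → Polynomial k}
    (hUV : ∀ t r s : k, (∀ i, r * (U i).eval t + s * (V i).eval t = 0) → r = 0 ∧ s = 0)
    (hW : ∀ t : k, ∃ r s : k, ∀ i, (W i).eval t = r * (U i).eval t + s * (V i).eval t) :
    ∃ f g : Polynomial k, W = f • U + g • V := by
  let S := Submodule.span (Polynomial k) {U, V}
  let I : Ideal (Polynomial k) := S.comap (LinearMap.toSpanSingleton _ _ W)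
  have hminor (i j : ι) : U i * V j - U j * V i ∈ I := by
    refine Submodule.mem_span_pair.mpr
      ⟨W i * V j - W j * V i, U i * W j - U j * W i, ?_⟩
    ext1 l
    refine Polynomial.funext fun t => ?_
    obtain ⟨r, s, hrs⟩ := hW t
    simp [hrs]
    ring
  have htop : I = ⊤ := by
    obtain ⟨g, hg⟩ := (IsPrincipalIdealRing.principal I).principal
    by_contra hI
    have hg' : ¬ IsUnit g := by
      rwa [← Ideal.span_singleton_eq_top, ← Ideal.submodule_span_eq, ← hg]
    obtain ⟨t, ht⟩ : ∃ t, g.IsRoot t := by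
      by_cases h0 : g = 0
      · exact ⟨0, by simp [h0]⟩
      · exact IsAlgClosed.exists_root g fun h => hg' (Polynomial.isUnit_iff_degree_eq_zero.mpr h)
    have hz (i j : ι) : (U i).eval t * (V j).eval t = (U j).eval t * (V i).eval t := by
      have hm := hminor i j
      rw [hg, Ideal.submodule_span_eq, Ideal.mem_span_singleton] at hm
      have := ht.dvd hm
      simpa [Polynomial.IsRoot, sub_eq_zero] using this
    by_cases hV : ∀ i, (V i).eval t = 0
    · exact one_ne_zero (hUV t 0 1 (by simp [hV])).2
    · push Not at hV
      obtain ⟨j, hj⟩ := hV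
      exact hj (hUV t ((V j).eval t) (-(U j).eval t) fun i => by
        linear_combination hz i j).1
  have h1 : (1 : Polynomial k) ∈ I := htop ▸ Submodule.mem_top
  obtain ⟨f, g, hfg⟩ := Submodule.mem_span_pair.mp (show (1 : Polynomial k) • W ∈ S from h1)
  exact ⟨f, g, by rw [hfg, one_smul]⟩

/-- A binary quadratic form in `z, w` with vector coefficients that is pointwise on `ℙ¹` a
combination of two pointwise independent ones is a constant combination of them. -/
theorem exists_constant_combination {k ι : Type*} [Field k] [IsAlgClosed k]
    {u v q : Fin 3 → ι → k}
    (huv : ∀ z w r s : k, z ≠ 0 ∨ w ≠ 0 →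
      r • (z ^ 2 • u 0 + (z * w) • u 1 + w ^ 2 • u 2) +
        s • (z ^ 2 • v 0 + (z * w) • v 1 + w ^ 2 • v 2) = 0 → r = 0 ∧ s = 0)
    (hq : ∀ z w : k, z ≠ 0 ∨ w ≠ 0 → ∃ r s : k, z ^ 2 • q 0 + (z * w) • q 1 + w ^ 2 • q 2 =
      r • (z ^ 2 • u 0 + (z * w) • u 1 + w ^ 2 • u 2) +
        s • (z ^ 2 • v 0 + (z * w) • v 1 + w ^ 2 • v 2)) :
    ∃ r s : k, q = r • u + s • v := by
  let P (y : Fin 3 → ι → k) (i : ι) : Polynomial k :=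
    Polynomial.C (y 0 i) * Polynomial.X ^ 2 + Polynomial.C (y 1 i) * Polynomial.X +
      Polynomial.C (y 2 i)
  have heval (y t i) : (P y i).eval t = (t ^ 2 • y 0 + (t * 1) • y 1 + (1 : k) ^ 2 • y 2) i := by
    simp [P]; ring
  have hdeg (y i) : (P y i).natDegree ≤ 2 := Polynomial.natDegree_quadratic_le
  have hcoeff (y i) : (P y i).coeff 2 = y 0 i ∧ (P y i).coeff 1 = y 1 i ∧
      (P y i).coeff 0 = y 2 i := by
    simp [P, Polynomial.coeff_X, Polynomial.coeff_C]
  obtain ⟨f, g, hfg⟩ := exists_polynomial_combination (U := P u) (V := P v) (W := P q)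
    (fun t r s h => huv t 1 r s (by simp) (by
      ext i; simpa only [heval, Pi.add_apply, Pi.smul_apply, smul_eq_mul, Pi.zero_apply] using h i))
    (fun t => by
      obtain ⟨r, s, h⟩ := hq t 1 (by simp)
      refine ⟨r, s, fun i => ?_⟩
      simpa only [heval, Pi.add_apply, Pi.smul_apply, smul_eq_mul] using congrFun h i)
  have htop (n : ℕ) (hn : 0 < n) (hf : f.natDegree ≤ n) (hg : g.natDegree ≤ n) :
      f.coeff n = 0 ∧ g.coeff n = 0 := by
    refine huv 1 0 _ _ (by simp) ?_
    ext i
    have := congrArg (Polynomial.coeff · (n + 2)) (congrFun hfg i)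
    simp only [Pi.add_apply, Pi.smul_apply, smul_eq_mul, Polynomial.coeff_add] at this
    rw [Polynomial.coeff_mul_add_eq_of_natDegree_le hf (hdeg u i),
      Polynomial.coeff_mul_add_eq_of_natDegree_le hg (hdeg v i),
      Polynomial.coeff_eq_zero_of_natDegree_lt (lt_of_le_of_lt (hdeg q i) (by omega)),
      (hcoeff u i).1, (hcoeff v i).1] at this
    simp [← this]
  have hconst (n : ℕ) : f.natDegree ≤ n → g.natDegree ≤ n →
      f.natDegree ≤ 0 ∧ g.natDegree ≤ 0 := by
    induction n with
    | zero => exact fun hf hg => ⟨hf, hg⟩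
    | succ n ih =>
      intro hf hg
      obtain ⟨hf', hg'⟩ := htop _ n.succ_pos hf hg
      exact ih (Polynomial.natDegree_le_pred hf hf') (Polynomial.natDegree_le_pred hg hg')
  obtain ⟨hf, hg⟩ := hconst (max f.natDegree g.natDegree) (le_max_left _ _) (le_max_right _ _)
  rw [Polynomial.eq_C_of_natDegree_le_zero hf, Polynomial.eq_C_of_natDegree_le_zero hg] at hfg
  refine ⟨f.coeff 0, g.coeff 0, ?_⟩
  ext j i
  have (n : ℕ) := congrArg (Polynomial.coeff · n) (congrFun hfg i)
  simp only [Pi.add_apply, Pi.smul_apply, smul_eq_mul, Polynomial.coeff_add,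
    Polynomial.coeff_C_mul] at this
  fin_cases j
  · simpa [hcoeff] using this 2
  · simpa [hcoeff] using this 1
  · simpa [hcoeff] using this 0

theorem cubic_coeffs_eq_zero {k : Type*} [Field k] [Infinite k] {a b c d e : Fin 3 → k}
    (h : ∀ x y : k, (x • a + y • b) ⬝ᵥ (x ^ 2 • c + (x * y) • d + y ^ 2 • e) = 0) :
    a ⬝ᵥ c = 0 ∧ a ⬝ᵥ d + b ⬝ᵥ c = 0 ∧ a ⬝ᵥ e + b ⬝ᵥ d = 0 ∧ b ⬝ᵥ e = 0 := by
  have hp : (Polynomial.C (a ⬝ᵥ c) * Polynomial.X ^ 3 +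
      Polynomial.C (a ⬝ᵥ d + b ⬝ᵥ c) * Polynomial.X ^ 2 +
      Polynomial.C (a ⬝ᵥ e + b ⬝ᵥ d) * Polynomial.X + Polynomial.C (b ⬝ᵥ e) :
      Polynomial k) = 0 := by
    refine Polynomial.funext fun x => ?_
    have := h x 1
    simp only [add_dotProduct, dotProduct_add, smul_dotProduct, dotProduct_smul,
      smul_eq_mul] at this
    simp
    linear_combination this
  have hc (n : ℕ) := congrArg (Polynomial.coeff · n) hp
  refine ⟨?_, ?_, ?_, ?_⟩
  · simpa [-map_add, Polynomial.coeff_X, Polynomial.coeff_X_pow, Polynomial.coeff_C] using hc 3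
  · simpa [-map_add, Polynomial.coeff_X, Polynomial.coeff_X_pow, Polynomial.coeff_C] using hc 2
  · simpa [-map_add, Polynomial.coeff_X, Polynomial.coeff_X_pow, Polynomial.coeff_C] using hc 1
  · simpa [-map_add, Polynomial.coeff_X, Polynomial.coeff_X_pow, Polynomial.coeff_C] using hc 0

theorem Bihom.exponents {k : Type*} [Field k] {p : Rk k} {m n : ℤ} (h : Bihom p m n)
    {v : Fin 4 →₀ ℕ} (hv : v ∈ p.support) :
    (v 0 + v 1 : ℤ) = m ∧ (v 2 + v 3 : ℤ) = n := by
  have := h (mem_support_iff.mp hv)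
  rw [Finsupp.weight_apply, Finsupp.sum_fintype _ _ (by simp)] at this
  simpa [Fin.sum_univ_four, bidegWt, Prod.ext_iff] using this

theorem monomial_eq_mul_pow {k : Type*} [Field k] (v : Fin 4 →₀ ℕ) (r : k) :
    monomial v r = C r * (X 0 ^ v 0 * X 1 ^ v 1 * X 2 ^ v 2 * X 3 ^ v 3) := by
  rw [monomial_eq, Finsupp.prod_fintype _ _ (by simp), Fin.prod_univ_four]

theorem Bihom.exists_linear {k : Type*} [Field k] {p : Rk k} (h : Bihom p 0 1) :
    ∃ r s : k, p = C r * X 2 + C s * X 3 := by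
  rw [p.as_sum]
  refine Finset.sum_induction _ (fun q => ∃ r s : k, q = C r * X 2 + C s * X 3) ?_ ?_ ?_
  · rintro _ _ ⟨r, s, rfl⟩ ⟨r', s', rfl⟩
    exact ⟨r + r', s + s', by simp only [map_add]; ring⟩
  · exact ⟨0, 0, by simp⟩
  · intro v hv
    obtain ⟨h₁, h₂⟩ := h.exponents hv
    rw [monomial_eq_mul_pow]
    have e0 : v 0 = 0 := by omega
    have e1 : v 1 = 0 := by omega
    obtain ⟨e2, e3⟩ | ⟨e2, e3⟩ : (v 2 = 1 ∧ v 3 = 0) ∨ (v 2 = 0 ∧ v 3 = 1) := by omega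
    · exact ⟨coeff v p, 0, by simp [e0, e1, e2, e3]⟩
    · exact ⟨0, coeff v p, by simp [e0, e1, e2, e3]⟩

/-- The polynomial of bidegree `(1, 2)` with prescribed coefficients. -/
def bidegOneTwo {k : Type*} [Field k] (a b : Fin 3 → k) : Rk k :=
  (C (a 0) * X 2 ^ 2 + C (a 1) * (X 2 * X 3) + C (a 2) * X 3 ^ 2) * X 0 +
    (C (b 0) * X 2 ^ 2 + C (b 1) * (X 2 * X 3) + C (b 2) * X 3 ^ 2) * X 1

theorem Bihom.exists_bidegOneTwo {k : Type*} [Field k] {p : Rk k} (h : Bihom p 1 2) :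
    ∃ a b : Fin 3 → k, p = bidegOneTwo a b := by
  rw [p.as_sum]
  refine Finset.sum_induction _ (fun q => ∃ a b : Fin 3 → k, q = bidegOneTwo a b) ?_ ?_ ?_
  · rintro _ _ ⟨a, b, rfl⟩ ⟨a', b', rfl⟩
    exact ⟨a + a', b + b', by simp only [bidegOneTwo, Pi.add_apply, map_add]; ring⟩
  · exact ⟨0, 0, by simp [bidegOneTwo]⟩
  · intro v hv
    obtain ⟨h₁, h₂⟩ := h.exponents hv
    rw [monomial_eq_mul_pow]
    obtain ⟨e0, e1⟩ | ⟨e0, e1⟩ : (v 0 = 1 ∧ v 1 = 0) ∨ (v 0 = 0 ∧ v 1 = 1) := by omega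
    all_goals
      obtain ⟨e2, e3⟩ | ⟨e2, e3⟩ | ⟨e2, e3⟩ :
        (v 2 = 2 ∧ v 3 = 0) ∨ (v 2 = 1 ∧ v 3 = 1) ∨ (v 2 = 0 ∧ v 3 = 2) := by omega
    · exact ⟨![coeff v p, 0, 0], 0, by simp [bidegOneTwo, e0, e1, e2, e3]; ring⟩
    · exact ⟨![0, coeff v p, 0], 0, by simp [bidegOneTwo, e0, e1, e2, e3]; ring⟩
    · exact ⟨![0, 0, coeff v p], 0, by simp [bidegOneTwo, e0, e1, e2, e3]; ring⟩
    · exact ⟨0, ![coeff v p, 0, 0], by simp [bidegOneTwo, e0, e1, e2, e3]; ring⟩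
    · exact ⟨0, ![0, coeff v p, 0], by simp [bidegOneTwo, e0, e1, e2, e3]; ring⟩
    · exact ⟨0, ![0, 0, coeff v p], by simp [bidegOneTwo, e0, e1, e2, e3]; ring⟩

theorem mem_SyzPiece_three_three {k : Type*} [Field k] {p A : Fin 3 → Rk k} :
    A ∈ SyzPiece p 3 3 ↔ (∀ i, Bihom (A i) 1 2) ∧ A 0 * p 0 + A 1 * p 1 + A 2 * p 2 = 0 := by
  have : ((3 - 2, 3 - 1) : ℤ × ℤ) = (1, 2) := by norm_num
  simp only [SyzPiece, this, Submodule.mem_inf, Submodule.mem_pi, Set.mem_univ, true_imp_iff,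
    LinearMap.mem_ker, syzMapk, Fin.sum_univ_three]
  rfl

theorem Bihom.mul {k : Type*} [Field k] {p q : Rk k} {m n m' n' : ℤ} (hp : Bihom p m n)
    (hq : Bihom q m' n') : Bihom (p * q) (m + m') (n + n') :=
  IsWeightedHomogeneous.mul hp hq

theorem Bihom.add {k : Type*} [Field k] {p q : Rk k} {m n : ℤ} (hp : Bihom p m n)
    (hq : Bihom q m n) : Bihom (p + q) m n :=
  IsWeightedHomogeneous.add hp hq

theorem crossProduct_combination {k : Type*} [Field k] (z w : k) (a a' b b' : Fin 3 → k) :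
    crossProduct (z • a + w • a') (z • b + w • b') =
      z ^ 2 • crossProduct a b + (z * w) • (crossProduct a b' + crossProduct a' b) +
        w ^ 2 • crossProduct a' b' := by
  simp only [map_add, map_smul, LinearMap.add_apply, LinearMap.smul_apply]
  module

/-- Coefficients in `z, w` of the cross product of two vectors of linear forms. -/
def crossCoeff {k : Type*} [Field k] (a b : Fin 2 → Fin 3 → k) : Fin 3 → Fin 3 → k :=
  ![crossProduct (a 0) (b 0), crossProduct (a 0) (b 1) + crossProduct (a 1) (b 0),
    crossProduct (a 1) (b 1)]

theorem exists_syzygy_combination {k : Type*} [Field k] [IsAlgClosed k]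
    {c d e : Fin 2 → Fin 3 → k}
    (h : ∀ z w : k, z ≠ 0 ∨ w ≠ 0 →
      NoQuadraticZero (z • c 0 + w • c 1) (z • d 0 + w • d 1) (z • e 0 + w • e 1))
    {a b : Fin 3 → Fin 3 → k}
    (hab : ∀ z w x y : k,
      (x • (z ^ 2 • a 0 + (z * w) • a 1 + w ^ 2 • a 2) +
        y • (z ^ 2 • b 0 + (z * w) • b 1 + w ^ 2 • b 2)) ⬝ᵥ
      (x ^ 2 • (z • c 0 + w • c 1) + (x * y) • (z • d 0 + w • d 1) +
        y ^ 2 • (z • e 0 + w • e 1)) = 0) :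
    ∃ r s : k, a = r • crossCoeff c e + s • crossCoeff c d ∧
      b = r • crossCoeff d e + s • crossCoeff c e := by
  have elim_quadratic (u v : Fin 3 → Fin 3 → k) (z w : k) :
      z ^ 2 • Sum.elim (u 0) (v 0) + (z * w) • Sum.elim (u 1) (v 1) +
        w ^ 2 • Sum.elim (u 2) (v 2) =
      Sum.elim (z ^ 2 • u 0 + (z * w) • u 1 + w ^ 2 • u 2)
        (z ^ 2 • v 0 + (z * w) • v 1 + w ^ 2 • v 2) := by
    ext (i | i) <;> simp
  have comb (u v u' v' : Fin 3 → k) (r s : k) :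
      r • Sum.elim u v + s • Sum.elim u' v' = Sum.elim (r • u + s • u') (r • v + s • v') := by
    ext (i | i) <;> simp
  have hcross (u v : Fin 2 → Fin 3 → k) (z w : k) :
      z ^ 2 • crossCoeff u v 0 + (z * w) • crossCoeff u v 1 + w ^ 2 • crossCoeff u v 2 =
        crossProduct (z • u 0 + w • u 1) (z • v 0 + w • v 1) :=
    (crossProduct_combination z w _ _ _ _).symm
  obtain ⟨r, s, hrs⟩ := exists_constant_combination
    (u := fun j => Sum.elim (crossCoeff c e j) (crossCoeff d e j))
    (v := fun j => Sum.elim (crossCoeff c d j) (crossCoeff c e j))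
    (q := fun j => Sum.elim (a j) (b j))
    (fun z w r s hzw hz => by
      simp only [elim_quadratic, hcross] at hz
      rw [comb] at hz
      refine (h z w hzw).cross_independent ?_ ?_
      · ext i; exact congrFun hz (Sum.inl i)
      · ext i; exact congrFun hz (Sum.inr i))
    (fun z w hzw => by
      simp only [elim_quadratic, hcross]
      have H := cubic_coeffs_eq_zero (hab z w)
      obtain ⟨r, s, h₁, h₂⟩ := (h z w hzw).exists_eq_cross H.1 H.2.1 H.2.2.1 H.2.2.2
      exact ⟨r, s, by rw [comb, h₁, h₂]⟩)
  refine ⟨r, s, ?_, ?_⟩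
  · ext j i; exact congrFun (congrFun hrs j) (Sum.inl i)
  · ext j i; exact congrFun (congrFun hrs j) (Sum.inr i)


theorem eval_bidegOneTwo {k : Type*} [Field k] (a b : Fin 3 → k) (x y z w : k) :
    eval ![x, y, z, w] (bidegOneTwo a b) =
      x * (z ^ 2 * a 0 + z * w * a 1 + w ^ 2 * a 2) +
        y * (z ^ 2 * b 0 + z * w * b 1 + w ^ 2 * b 2) := by
  simp [bidegOneTwo]
  ring

theorem bidegOneTwo_combination {k : Type*} [Field k] (r s : k) (a b a' b' : Fin 3 → k) :
    bidegOneTwo (r • a + s • a') (r • b + s • b') =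
      r • bidegOneTwo a b + s • bidegOneTwo a' b' := by
  simp only [bidegOneTwo, Pi.add_apply, Pi.smul_apply, smul_eq_mul, map_add, map_mul, smul_eq_C_mul]
  ring

theorem bihom_bidegOneTwo {k : Type*} [Field k] (a b : Fin 3 → k) :
    Bihom (bidegOneTwo a b) 1 2 := by
  have hC (r : k) : Bihom (C r) 0 0 := isWeightedHomogeneous_C _ r
  have hX : Bihom (X 0 : Rk k) 1 0 := isWeightedHomogeneous_X k bidegWt 0
  have hY : Bihom (X 1 : Rk k) 1 0 := isWeightedHomogeneous_X k bidegWt 1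
  have hZ : Bihom (X 2 : Rk k) 0 1 := isWeightedHomogeneous_X k bidegWt 2
  have hW : Bihom (X 3 : Rk k) 0 1 := isWeightedHomogeneous_X k bidegWt 3
  have hq (a : Fin 3 → k) :
      Bihom (C (a 0) * X 2 ^ 2 + C (a 1) * (X 2 * X 3) + C (a 2) * X 3 ^ 2) 0 2 := by
    rw [sq, sq]
    exact (((hC _).mul (hZ.mul hZ)).add ((hC _).mul (hZ.mul hW))).add ((hC _).mul (hW.mul hW))
  exact ((hq a).mul hX).add ((hq b).mul hY)

/-- The vector of polynomials of bidegree `(1, 2)` with prescribed vector coefficients. -/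
def bidegOneTwoVec {k : Type*} [Field k] (a b : Fin 3 → Fin 3 → k) : Fin 3 → Rk k :=
  fun i => bidegOneTwo (fun j => a j i) (fun j => b j i)

theorem bidegOneTwoVec_combination {k : Type*} [Field k] (r s : k)
    (a b a' b' : Fin 3 → Fin 3 → k) :
    bidegOneTwoVec (r • a + s • a') (r • b + s • b') =
      r • bidegOneTwoVec a b + s • bidegOneTwoVec a' b' :=
  funext fun _ => bidegOneTwo_combination r s _ _ _ _

theorem eval_bidegOneTwoVec {k : Type*} [Field k] (a b : Fin 3 → Fin 3 → k) (x y z w : k)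
    (i : Fin 3) :
    eval ![x, y, z, w] (bidegOneTwoVec a b i) =
      (x • (z ^ 2 • a 0 + (z * w) • a 1 + w ^ 2 • a 2) +
        y • (z ^ 2 • b 0 + (z * w) • b 1 + w ^ 2 • b 2)) i :=
  eval_bidegOneTwo _ _ x y z w

theorem exists_eq_bidegOneTwoVec {k : Type*} [Field k] {A : Fin 3 → Rk k}
    (h : ∀ i, Bihom (A i) 1 2) : ∃ a b, A = bidegOneTwoVec a b := by
  choose a b hab using fun i => (h i).exists_bidegOneTwo
  exact ⟨fun j i => a i j, fun j i => b i j, funext hab⟩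

/-- The vector of linear forms in `z, w` with prescribed vector coefficients. -/
def linearVec {k : Type*} [Field k] (c : Fin 2 → Fin 3 → k) : Fin 3 → Rk k :=
  fun i => C (c 0 i) * X 2 + C (c 1 i) * X 3

theorem exists_eq_linearVec {k : Type*} [Field k] {F : Fin 3 → Rk k}
    (h : ∀ i, Bihom (F i) 0 1) : ∃ c, F = linearVec c := by
  choose r s hrs using fun i => (h i).exists_linear
  exact ⟨![r, s], funext hrs⟩

theorem eval_linearVec {k : Type*} [Field k] (c : Fin 2 → Fin 3 → k) (x y z w : k) (i : Fin 3) :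
    eval ![x, y, z, w] (linearVec c i) = (z • c 0 + w • c 1) i := by
  simp [linearVec]
  ring

theorem linearIndependent_cross_syzygies {k : Type*} [Field k] [IsAlgClosed k]
    {c d e : Fin 2 → Fin 3 → k} (h : NoQuadraticZero (c 1) (d 1) (e 1)) :
    LinearIndependent k ![bidegOneTwoVec (crossCoeff c e) (crossCoeff d e),
      bidegOneTwoVec (crossCoeff c d) (crossCoeff c e)] := by
  rw [LinearIndependent.pair_iff]
  intro r s hrs
  rw [← bidegOneTwoVec_combination] at hrs
  have key (x y : k) (i : Fin 3) := congrArg (eval ![x, y, 0, 1]) (congrFun hrs i)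
  simp only [eval_bidegOneTwoVec, Pi.zero_apply, map_zero] at key
  refine h.cross_independent ?_ ?_
  · ext i
    simpa [crossCoeff] using key 1 0 i
  · ext i
    simpa [crossCoeff] using key 0 1 i

end

/-- **Proposition 6.4.** Writing `pᵢ = Cᵢ(z,w) x² + Dᵢ(z,w) xy + Eᵢ(z,w) y²`,
the two explicit syzygies `C⁽¹⁾, C⁽²⁾` are linearly independent over `k` and span
`Syz(p)_{3,3}`. -/
theorem statement11 {k : Type*} [Field k] [IsAlgClosed k] (p0 p1 p2 : Rk k)
    (h0 : Bihom p0 2 1) (h1 : Bihom p1 2 1) (h2 : Bihom p2 2 1)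
    (hncz : NoCommonZeros p0 p1 p2)
    (C D E : Fin 3 → Rk k)
    (hC : ∀ i, Bihom (C i) 0 1) (hD : ∀ i, Bihom (D i) 0 1) (hE : ∀ i, Bihom (E i) 0 1)
    (hp0 : p0 = C 0 * X 0 ^ 2 + D 0 * (X 0 * X 1) + E 0 * X 1 ^ 2)
    (hp1 : p1 = C 1 * X 0 ^ 2 + D 1 * (X 0 * X 1) + E 1 * X 1 ^ 2)
    (hp2 : p2 = C 2 * X 0 ^ 2 + D 2 * (X 0 * X 1) + E 2 * X 1 ^ 2) :
    (![(C 1 * X 0 + D 1 * X 1) * E 2 - (C 2 * X 0 + D 2 * X 1) * E 1,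
       (C 2 * X 0 + D 2 * X 1) * E 0 - (C 0 * X 0 + D 0 * X 1) * E 2,
       (C 0 * X 0 + D 0 * X 1) * E 1 - (C 1 * X 0 + D 1 * X 1) * E 0] : Fin 3 → Rk k)
        ∈ SyzPiece ![p0, p1, p2] 3 3 ∧
    (![C 1 * (D 2 * X 0 + E 2 * X 1) - C 2 * (D 1 * X 0 + E 1 * X 1),
       C 2 * (D 0 * X 0 + E 0 * X 1) - C 0 * (D 2 * X 0 + E 2 * X 1),
       C 0 * (D 1 * X 0 + E 1 * X 1) - C 1 * (D 0 * X 0 + E 0 * X 1)] : Fin 3 → Rk k)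
        ∈ SyzPiece ![p0, p1, p2] 3 3 ∧
    LinearIndependent k
      ![(![(C 1 * X 0 + D 1 * X 1) * E 2 - (C 2 * X 0 + D 2 * X 1) * E 1,
          (C 2 * X 0 + D 2 * X 1) * E 0 - (C 0 * X 0 + D 0 * X 1) * E 2,
          (C 0 * X 0 + D 0 * X 1) * E 1 - (C 1 * X 0 + D 1 * X 1) * E 0] : Fin 3 → Rk k),
        (![C 1 * (D 2 * X 0 + E 2 * X 1) - C 2 * (D 1 * X 0 + E 1 * X 1),
          C 2 * (D 0 * X 0 + E 0 * X 1) - C 0 * (D 2 * X 0 + E 2 * X 1),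
          C 0 * (D 1 * X 0 + E 1 * X 1) - C 1 * (D 0 * X 0 + E 0 * X 1)] : Fin 3 → Rk k)] ∧
    Submodule.span k
      ({![(C 1 * X 0 + D 1 * X 1) * E 2 - (C 2 * X 0 + D 2 * X 1) * E 1,
          (C 2 * X 0 + D 2 * X 1) * E 0 - (C 0 * X 0 + D 0 * X 1) * E 2,
          (C 0 * X 0 + D 0 * X 1) * E 1 - (C 1 * X 0 + D 1 * X 1) * E 0],
        ![C 1 * (D 2 * X 0 + E 2 * X 1) - C 2 * (D 1 * X 0 + E 1 * X 1),
          C 2 * (D 0 * X 0 + E 0 * X 1) - C 0 * (D 2 * X 0 + E 2 * X 1),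
          C 0 * (D 1 * X 0 + E 1 * X 1) - C 1 * (D 0 * X 0 + E 0 * X 1)]} :
        Set (Fin 3 → Rk k))
      = SyzPiece ![p0, p1, p2] 3 3 := by
  obtain ⟨c, rfl⟩ := exists_eq_linearVec hC
  obtain ⟨d, rfl⟩ := exists_eq_linearVec hD
  obtain ⟨e, rfl⟩ := exists_eq_linearVec hE
  have heval (x y z w : k) (i : Fin 3) : eval ![x, y, z, w] (![p0, p1, p2] i) =
      (x ^ 2 • (z • c 0 + w • c 1) + (x * y) • (z • d 0 + w • d 1) +
        y ^ 2 • (z • e 0 + w • e 1)) i := by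
    have hp : ![p0, p1, p2] i = linearVec c i * X 0 ^ 2 + linearVec d i * (X 0 * X 1) +
        linearVec e i * X 1 ^ 2 := by
      fin_cases i
      exacts [hp0, hp1, hp2]
    rw [hp]
    simp only [map_add, map_mul, map_pow, eval_linearVec, eval_X, Matrix.cons_val,
      Pi.add_apply, Pi.smul_apply, smul_eq_mul]
    ring
  have hnz (z w : k) (hzw : z ≠ 0 ∨ w ≠ 0) :
      NoQuadraticZero (z • c 0 + w • c 1) (z • d 0 + w • d 1) (z • e 0 + w • e 1) := by
    intro x y hxy h
    have hz (i : Fin 3) : eval ![x, y, z, w] (![p0, p1, p2] i) = 0 := by rw [heval, h]; rfl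
    rcases hncz x y z w (by simpa [imp_iff_not_or] using hxy)
      (by simpa [imp_iff_not_or] using hzw) with h | h | h
    exacts [h (hz 0), h (hz 1), h (hz 2)]
  have hS₁ : ![(linearVec c 1 * X 0 + linearVec d 1 * X 1) * linearVec e 2 -
        (linearVec c 2 * X 0 + linearVec d 2 * X 1) * linearVec e 1,
      (linearVec c 2 * X 0 + linearVec d 2 * X 1) * linearVec e 0 -
        (linearVec c 0 * X 0 + linearVec d 0 * X 1) * linearVec e 2,
      (linearVec c 0 * X 0 + linearVec d 0 * X 1) * linearVec e 1 -
        (linearVec c 1 * X 0 + linearVec d 1 * X 1) * linearVec e 0] =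
      bidegOneTwoVec (crossCoeff c e) (crossCoeff d e) := by
    ext1 i
    fin_cases i <;>
    · simp [linearVec, bidegOneTwoVec, bidegOneTwo, crossCoeff, cross_apply]
      ring
  have hS₂ : ![linearVec c 1 * (linearVec d 2 * X 0 + linearVec e 2 * X 1) -
        linearVec c 2 * (linearVec d 1 * X 0 + linearVec e 1 * X 1),
      linearVec c 2 * (linearVec d 0 * X 0 + linearVec e 0 * X 1) -
        linearVec c 0 * (linearVec d 2 * X 0 + linearVec e 2 * X 1),
      linearVec c 0 * (linearVec d 1 * X 0 + linearVec e 1 * X 1) -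
        linearVec c 1 * (linearVec d 0 * X 0 + linearVec e 0 * X 1)] =
      bidegOneTwoVec (crossCoeff c d) (crossCoeff c e) := by
    ext1 i
    fin_cases i <;>
    · simp [linearVec, bidegOneTwoVec, bidegOneTwo, crossCoeff, cross_apply]
      ring
  have hmem₁ : bidegOneTwoVec (crossCoeff c e) (crossCoeff d e) ∈ SyzPiece ![p0, p1, p2] 3 3 := by
    refine mem_SyzPiece_three_three.mpr ⟨fun i => bihom_bidegOneTwo _ _, ?_⟩
    rw [← hS₁]
    simp only [Matrix.cons_val, hp0, hp1, hp2]
    ring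
  have hmem₂ : bidegOneTwoVec (crossCoeff c d) (crossCoeff c e) ∈ SyzPiece ![p0, p1, p2] 3 3 := by
    refine mem_SyzPiece_three_three.mpr ⟨fun i => bihom_bidegOneTwo _ _, ?_⟩
    rw [← hS₂]
    simp only [Matrix.cons_val, hp0, hp1, hp2]
    ring
  rw [hS₁, hS₂]
  refine ⟨hmem₁, hmem₂, linearIndependent_cross_syzygies (by simpa using hnz 0 1 (by simp)),
    le_antisymm (Submodule.span_le.mpr (Set.pair_subset hmem₁ hmem₂)) fun A hA => ?_⟩
  obtain ⟨hA₁, hA₂⟩ := mem_SyzPiece_three_three.mp hA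
  obtain ⟨a, b, rfl⟩ := exists_eq_bidegOneTwoVec hA₁
  obtain ⟨r, s, rfl, rfl⟩ := exists_syzygy_combination hnz (a := a) (b := b) fun z w x y => by
    have := congrArg (eval ![x, y, z, w]) hA₂
    simp only [map_add, map_mul, map_zero, heval, eval_bidegOneTwoVec] at this
    rw [dotProduct, Fin.sum_univ_three]
    exact this
  rw [bidegOneTwoVec_combination]
  exact Submodule.mem_span_pair.mpr ⟨r, s, rfl⟩
end
end

section
/- Let p0, p1, p2 ∈ R_{2,1} have no common zeros on P^1 × P^1 and be non-generic. Then there exist g0, g1 ∈ R_{2,0} having no common zero in k^2 ∖ {(0,0)} such that the k-linear span of {p0, p1, p2} equals the k-linear span of {g0 z, g1 w, (g0 + g1)(z + w)}. Moreover g0, g1 form a regular sequence in R, and g0 z, g1 w form a regular sequence in R. -/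
open MvPolynomial

noncomputable section

lemma range_vecCons_three {α : Type*} (a b c : α) : Set.range ![a, b, c] = {a, b, c} := by
  ext x
  simp [eq_comm]
  tauto

section LinearAlgebra

variable {k : Type*} [Field k]

/-- A binary form of degree `n ≥ 1` over an algebraically closed field has a nontrivial zero. -/
lemma exists_root_binary_form [IsAlgClosed k] (n : ℕ) (hn : n ≠ 0) (e : ℕ → k) :
    ∃ x y : k, (x, y) ≠ (0, 0) ∧ ∑ i ∈ Finset.range (n + 1), e i * x ^ i * y ^ (n - i) = 0 := by
  by_cases h : e n = 0
  · refine ⟨1, 0, by simp, ?_⟩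
    rw [Finset.sum_range_succ, h, Finset.sum_eq_zero]
    · simp
    · intro i hi
      rw [Finset.mem_range] at hi
      simp [Nat.sub_ne_zero_of_lt hi]
  · let f : Polynomial k := ∑ i ∈ Finset.range (n + 1), Polynomial.C (e i) * Polynomial.X ^ i
    have hf : f.coeff n = e n := by
      simp [f, Polynomial.coeff_C_mul, Polynomial.coeff_X_pow]
    have hd : f.degree ≠ 0 := by
      intro h0
      have := Polynomial.le_natDegree_of_ne_zero (n := n) (p := f) (by rwa [hf])
      rw [Polynomial.natDegree_eq_of_degree_eq_some h0] at this
      exact hn (Nat.le_zero.mp this)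
    obtain ⟨x, hx⟩ := IsAlgClosed.exists_root f hd
    refine ⟨x, 1, by simp, ?_⟩
    simpa [f, Polynomial.IsRoot, Polynomial.eval_finsetSum] using hx

/-- The value at `(x, y)` of the binary quadratic form with coefficient vector `v`. -/
def quadEval (x y : k) : (Fin 3 → k) →ₗ[k] k :=
  Fintype.linearCombination k ![x ^ 2, x * y, y ^ 2]

lemma quadEval_apply (x y : k) (v : Fin 3 → k) :
    quadEval x y v = v 0 * x ^ 2 + v 1 * (x * y) + v 2 * y ^ 2 := by
  simp [quadEval, Fintype.linearCombination_apply, Fin.sum_univ_three]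

lemma quadEval_injective {v v' : Fin 3 → k} (h : ∀ x y, quadEval x y v = quadEval x y v') :
    v = v' := by
  simp only [quadEval_apply] at h
  have h0 : v 0 = v' 0 := by simpa using h 1 0
  have h2 : v 2 = v' 2 := by simpa using h 0 1
  have h1 : v 1 = v' 1 := by simpa [h0, h2] using h 1 1
  ext i
  fin_cases i <;> assumption

lemma exists_quadEval_eq_zero [IsAlgClosed k] (v : Fin 3 → k) :
    ∃ x y : k, (x, y) ≠ (0, 0) ∧ quadEval x y v = 0 := by
  obtain ⟨x, y, hxy, h⟩ := exists_root_binary_form 2 two_ne_zero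
    (fun i => if i = 0 then v 2 else if i = 1 then v 1 else v 0)
  refine ⟨x, y, hxy, ?_⟩
  simp [Finset.sum_range_succ] at h
  rw [quadEval_apply]
  linear_combination h

lemma exists_quadEval_mul_sub_mul_eq_zero [IsAlgClosed k] (u v u' v' : Fin 3 → k) :
    ∃ x y : k, (x, y) ≠ (0, 0) ∧
      quadEval x y u * quadEval x y v' - quadEval x y v * quadEval x y u' = 0 := by
  obtain ⟨x, y, hxy, h⟩ := exists_root_binary_form 4 four_ne_zero
    (fun i => if i = 0 then u 2 * v' 2 - v 2 * u' 2
      else if i = 1 then u 1 * v' 2 + u 2 * v' 1 - (v 1 * u' 2 + v 2 * u' 1)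
      else if i = 2 then u 0 * v' 2 + u 1 * v' 1 + u 2 * v' 0
        - (v 0 * u' 2 + v 1 * u' 1 + v 2 * u' 0)
      else if i = 3 then u 0 * v' 1 + u 1 * v' 0 - (v 0 * u' 1 + v 1 * u' 0)
      else u 0 * v' 0 - v 0 * u' 0)
  refine ⟨x, y, hxy, ?_⟩
  simp [Finset.sum_range_succ] at h
  simp only [quadEval_apply]
  linear_combination h

/-- A linear map out of `k³` killing two independent vectors has rank at most one. -/
lemma exists_forall_eq_smul_of_pair_mem_ker {F : Type*} [AddCommGroup F] [Module k F]
    (f : (Fin 3 → k) →ₗ[k] F) {a b : Fin 3 → k} (hab : LinearIndependent k ![a, b])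
    (ha : f a = 0) (hb : f b = 0) : ∃ e : F, ∀ x, ∃ c : k, f x = c • e := by
  have h2 : 2 ≤ Module.finrank k (LinearMap.ker f) := by
    have hle : Submodule.span k (Set.range ![a, b]) ≤ LinearMap.ker f := by
      rw [Submodule.span_le]
      rintro _ ⟨i, rfl⟩
      fin_cases i <;> simpa
    simpa [finrank_span_eq_card hab] using Submodule.finrank_mono hle
  have h3 := f.finrank_range_add_finrank_ker
  rw [Module.finrank_fin_fun] at h3
  obtain ⟨e, he⟩ := finrank_le_one_iff.mp (show Module.finrank k (LinearMap.range f) ≤ 1 by omega)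
  refine ⟨e, fun x => ?_⟩
  obtain ⟨c, hc⟩ := he ⟨f x, LinearMap.mem_range_self f x⟩
  exact ⟨c, by simpa using (congrArg Subtype.val hc).symm⟩

variable (U V : (Fin 3 → k) →ₗ[k] (Fin 3 → k))

/-- The net of `(2,1)`-forms `a ↦ U a ⊗ z + V a ⊗ w` has no base point. -/
def BasePointFree : Prop :=
  ∀ x y c d : k, (x, y) ≠ (0, 0) → (c, d) ≠ (0, 0) →
    ∃ a, c * quadEval x y (U a) + d * quadEval x y (V a) ≠ 0

variable {U V}

lemma BasePointFree.not_linearIndependent_pair [IsAlgClosed k] (H : BasePointFree U V)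
    {c d : k} (hcd : (c, d) ≠ (0, 0)) {a b : Fin 3 → k}
    (ha : c • U a + d • V a = 0) (hb : c • U b + d • V b = 0) :
    ¬ LinearIndependent k ![a, b] := by
  intro hab
  obtain ⟨e, he⟩ := exists_forall_eq_smul_of_pair_mem_ker (c • U + d • V) hab
    (by simpa using ha) (by simpa using hb)
  obtain ⟨x, y, hxy, h0⟩ := exists_quadEval_eq_zero e
  obtain ⟨a', ha'⟩ := H x y c d hxy hcd
  obtain ⟨r, hr⟩ := he a'
  apply ha'
  have := congrArg (quadEval x y) hr
  simpa [h0] using this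

lemma exists_mul_add_mul_eq_zero (s t : k) : ∃ c d : k, (c, d) ≠ (0, 0) ∧ c * s + d * t = 0 := by
  by_cases h : s = 0
  · exact ⟨1, 0, by simp, by simp [h]⟩
  · exact ⟨-t, s, by simp [h], by ring⟩

/-- The net does not contain `v ⊗ l` and `v ⊗ l'` for independent linear forms `l`, `l'`. -/
lemma BasePointFree.mul_sub_mul_eq_zero [IsAlgClosed k] (H : BasePointFree U V)
    {a b v : Fin 3 → k} {α β α' β' : k} (hv : v ≠ 0)
    (hUa : U a = α • v) (hVa : V a = β • v) (hUb : U b = α' • v) (hVb : V b = β' • v) :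
    α * β' - β * α' = 0 := by
  by_contra hne
  have hab : LinearIndependent k ![a, b] := by
    rw [LinearIndependent.pair_iff]
    intro s t hst
    have hU := congrArg U hst
    have hV := congrArg V hst
    simp only [map_add, map_smul, hUa, hUb, hVa, hVb, map_zero, smul_smul, ← add_smul,
      smul_eq_zero, hv, or_false] at hU hV
    constructor
    · apply (mul_eq_zero.mp (_ : s * (α * β' - β * α') = 0)).resolve_right hne
      linear_combination β' * hU - α' * hV
    · apply (mul_eq_zero.mp (_ : t * (α * β' - β * α') = 0)).resolve_right hne
      linear_combination α * hV - β * hU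
  obtain ⟨x, y, hxy, h0⟩ := exists_quadEval_eq_zero v
  obtain ⟨e, he⟩ := exists_forall_eq_smul_of_pair_mem_ker
    ((quadEval x y ∘ₗ U).prod (quadEval x y ∘ₗ V)) hab
    (by simp [hUa, hVa, h0]) (by simp [hUb, hVb, h0])
  obtain ⟨c, d, hcd, h⟩ := exists_mul_add_mul_eq_zero e.1 e.2
  obtain ⟨a', ha'⟩ := H x y c d hxy hcd
  obtain ⟨r, hr⟩ := he a'
  have hr₁ : quadEval x y (U a') = r * e.1 := congrArg Prod.fst hr
  have hr₂ : quadEval x y (V a') = r * e.2 := congrArg Prod.snd hr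
  apply ha'
  rw [hr₁, hr₂]
  linear_combination r * h

/-- Two `(2,1)`-forms always have a common zero. -/
lemma exists_common_zero_pair [IsAlgClosed k] (u v u' v' : Fin 3 → k) :
    ∃ x y c d : k, (x, y) ≠ (0, 0) ∧ (c, d) ≠ (0, 0) ∧
      c * quadEval x y u + d * quadEval x y v = 0 ∧
      c * quadEval x y u' + d * quadEval x y v' = 0 := by
  obtain ⟨x, y, hxy, h⟩ := exists_quadEval_mul_sub_mul_eq_zero u v u' v'
  by_cases h0 : quadEval x y u = 0 ∧ quadEval x y v = 0
  · obtain ⟨c, d, hcd, h1⟩ := exists_mul_add_mul_eq_zero (quadEval x y u') (quadEval x y v')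
    exact ⟨x, y, c, d, hxy, hcd, by simp [h0], h1⟩
  · refine ⟨x, y, quadEval x y v, -quadEval x y u, hxy, ?_, by ring, by linear_combination -h⟩
    simpa [Prod.ext_iff, and_comm] using h0

lemma BasePointFree.eq_zero [IsAlgClosed k] (H : BasePointFree U V) {a : Fin 3 → k}
    (hU : U a = 0) (hV : V a = 0) : a = 0 := by
  by_contra ha
  obtain ⟨i, hi⟩ := Function.ne_iff.mp ha
  obtain ⟨b, c, hbc⟩ : ∃ b c : Fin 3 → k, ∀ x : Fin 3 → k, ∃ r s t : k,
      x = r • a + s • b + t • c := by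
    have key : ∀ j l : Fin 3, j ≠ i → l ≠ i → j ≠ l → ∃ b c : Fin 3 → k, ∀ x : Fin 3 → k,
        ∃ r s t : k, x = r • a + s • b + t • c := by
      intro j l hj hl hjl
      refine ⟨Pi.single j 1, Pi.single l 1, fun x => ⟨x i / a i, x j - x i / a i * a j,
        x l - x i / a i * a l, ?_⟩⟩
      have hi' : a i ≠ 0 := hi
      ext m
      have hm : m = i ∨ m = j ∨ m = l := by omega
      rcases hm with rfl | rfl | rfl
      · simp [hj.symm, hl.symm, hi']
      · simp [hjl]
      · simp [hjl.symm]
    fin_cases i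
    · exact key 1 2 (by decide) (by decide) (by decide)
    · exact key 0 2 (by decide) (by decide) (by decide)
    · exact key 0 1 (by decide) (by decide) (by decide)
  obtain ⟨x, y, p, q, hxy, hpq, h1, h2⟩ := exists_common_zero_pair (U b) (V b) (U c) (V c)
  obtain ⟨a', ha'⟩ := H x y p q hxy hpq
  obtain ⟨r, s, t, rfl⟩ := hbc a'
  apply ha'
  simp only [map_add, map_smul, hU, hV, smul_zero, zero_add, smul_eq_mul]
  linear_combination s * h1 + t * h2

/-- If every `[α : β]` supports an element `v ⊗ (α z + β w)` of the net, the net has a basis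
`v₀ ⊗ z`, `v₁ ⊗ w`, `(v₀ + v₁) ⊗ (z + w)`. -/
lemma BasePointFree.exists_normal_form [IsAlgClosed k] (H : BasePointFree U V)
    (hdeg : ∀ α β : k, (α, β) ≠ (0, 0) → ∃ a v : Fin 3 → k, a ≠ 0 ∧ U a = α • v ∧ V a = β • v) :
    ∃ (b : Fin 3 → Fin 3 → k) (v₀ v₁ : Fin 3 → k), LinearIndependent k b ∧
      U (b 0) = v₀ ∧ V (b 0) = 0 ∧ U (b 1) = 0 ∧ V (b 1) = v₁ ∧
      U (b 2) = v₀ + v₁ ∧ V (b 2) = v₀ + v₁ := by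
  have hdeg' : ∀ α β : k, (α, β) ≠ (0, 0) →
      ∃ a v : Fin 3 → k, a ≠ 0 ∧ v ≠ 0 ∧ U a = α • v ∧ V a = β • v := by
    intro α β h
    obtain ⟨a, v, ha, hU, hV⟩ := hdeg α β h
    refine ⟨a, v, ha, ?_, hU, hV⟩
    rintro rfl
    exact ha (H.eq_zero (by simpa using hU) (by simpa using hV))
  obtain ⟨a₀, v₀, -, hv₀, hU₀, hV₀⟩ := hdeg' 1 0 (by simp)
  obtain ⟨a₁, v₁, -, hv₁, hU₁, hV₁⟩ := hdeg' 0 1 (by simp)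
  obtain ⟨a₂, v₂, -, hv₂, hU₂, hV₂⟩ := hdeg' 1 1 (by simp)
  classical
  obtain ⟨t, ht⟩ := Infinite.exists_notMem_finset ({0, 1} : Finset k)
  obtain ⟨ht0, ht1⟩ : t ≠ 0 ∧ t ≠ 1 := by simpa using ht
  obtain ⟨a₃, v₃, ha₃, -, hU₃, hV₃⟩ := hdeg' 1 t (by simp)
  rw [one_smul] at hU₀ hV₁ hU₂ hV₂ hU₃
  rw [zero_smul] at hV₀ hU₁
  have n01 : ∀ r : k, v₁ ≠ r • v₀ := by
    rintro r rfl
    have := H.mul_sub_mul_eq_zero (α := 1) (β := 0) (α' := 0) (β' := r) hv₀ (by simpa using hU₀)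
      (by simpa using hV₀) (by simpa using hU₁) hV₁
    simp at this
    simp [this] at hv₁
  have n02 : ∀ r : k, v₂ ≠ r • v₀ := by
    rintro r rfl
    have := H.mul_sub_mul_eq_zero (α := 1) (β := 0) (α' := r) (β' := r) hv₀ (by simpa using hU₀)
      (by simpa using hV₀) hU₂ hV₂
    simp at this
    simp [this] at hv₂
  have n12 : ∀ r : k, v₂ ≠ r • v₁ := by
    rintro r rfl
    have := H.mul_sub_mul_eq_zero (α := 0) (β := 1) (α' := r) (β' := r) hv₁ (by simpa using hU₁)
      (by simpa using hV₁) hU₂ hV₂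
    simp at this
    simp [this] at hv₂
  have hind : LinearIndependent k ![a₀, a₁, a₂] := by
    rw [Fintype.linearIndependent_iff]
    intro g hg
    simp only [Fin.sum_univ_three, Matrix.cons_val] at hg
    have hU := congrArg U hg
    have hV := congrArg V hg
    simp only [map_add, map_smul, hU₀, hU₁, hU₂, hV₀, hV₁, hV₂, smul_zero, map_zero, zero_add,
      add_zero] at hU hV
    have h2 : g 2 = 0 := by
      by_contra h2
      apply n02 (-(g 2)⁻¹ * g 0)
      have : v₂ = (g 2)⁻¹ • (g 2 • v₂) := by simp [smul_smul, h2]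
      rw [this, eq_neg_of_add_eq_zero_right hU]
      simp [smul_smul]
    have h0 : g 0 = 0 := by simpa [h2, hv₀] using hU
    have h1 : g 1 = 0 := by simpa [h2, hv₁] using hV
    intro i
    fin_cases i <;> assumption
  obtain ⟨s, hs⟩ : ∃ s : Fin 3 → k, ∑ i, s i • ![a₀, a₁, a₂] i = a₃ := by
    have htop := hind.span_eq_top_of_card_eq_finrank' (by simp)
    have : a₃ ∈ Submodule.span k (Set.range ![a₀, a₁, a₂]) := by rw [htop]; trivial
    exact (Submodule.mem_span_range_iff_exists_fun k).mp this
  simp only [Fin.sum_univ_three, Matrix.cons_val] at hs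
  have hU := congrArg U hs
  have hV := congrArg V hs
  simp only [map_add, map_smul, hU₀, hU₁, hU₂, hV₀, hV₁, hV₂, hU₃, hV₃, smul_zero, zero_add,
    add_zero] at hU hV
  rw [← hU] at hV
  have rel : s 1 • v₁ = (t * s 0) • v₀ + ((t - 1) * s 2) • v₂ := by
    rw [eq_sub_of_add_eq hV]
    module
  have ht1' : t - 1 ≠ 0 := sub_ne_zero.mpr ht1
  have s2 : s 2 ≠ 0 := by
    intro h2
    simp only [h2, mul_zero, zero_smul, add_zero] at rel
    have h1 : s 1 = 0 := by
      by_contra h1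
      apply n01 ((s 1)⁻¹ * (t * s 0))
      rw [mul_smul, ← rel, smul_smul, inv_mul_cancel₀ h1, one_smul]
    have h0 : s 0 = 0 := by simpa [h1, hv₀, ht0] using rel.symm
    apply ha₃
    simp [← hs, h0, h1, h2]
  have hc : (t - 1) * s 2 ≠ 0 := mul_ne_zero ht1' s2
  obtain ⟨α, β, hαβ⟩ : ∃ α β : k, v₂ = α • v₀ + β • v₁ := by
    refine ⟨-((t - 1) * s 2)⁻¹ * (t * s 0), ((t - 1) * s 2)⁻¹ * s 1, ?_⟩
    rw [mul_smul _ (s 1), rel, smul_add, smul_smul _ ((t - 1) * s 2), inv_mul_cancel₀ hc]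
    module
  have hα : α ≠ 0 := by
    rintro rfl
    exact n12 β (by simpa using hαβ)
  have hβ : β ≠ 0 := by
    rintro rfl
    exact n02 α (by simpa using hαβ)
  refine ⟨![α • a₀, β • a₁, a₂], α • v₀, β • v₁, ?_, by simp [hU₀], by simp [hV₀], by simp [hU₁],
    by simp [hV₁], by simp [hU₂, hαβ], by simp [hV₂, hαβ]⟩
  have := hind.units_smul ![Units.mk0 α hα, Units.mk0 β hβ, 1]
  convert this using 1
  ext i
  fin_cases i <;> simp [Units.smul_def]

/-- If infinitely many points of the net are pure tensors, then every linear form occurs. -/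
lemma BasePointFree.exists_of_infinite [IsAlgClosed k] (H : BasePointFree U V)
    (hinf : {P : Projectivization k (Fin 3 → k) | ∃ (α β : k) (v : Fin 3 → k),
      U P.rep = α • v ∧ V P.rep = β • v}.Infinite) (α β : k) (hαβ : (α, β) ≠ (0, 0)) :
    ∃ a v : Fin 3 → k, a ≠ 0 ∧ U a = α • v ∧ V a = β • v := by
  obtain ⟨A, hA⟩ : ∃ A : Matrix (Fin 3) (Fin 3) k, ∀ a, A.mulVec a = U a :=
    ⟨LinearMap.toMatrix' U, LinearMap.toMatrix'_mulVec U⟩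
  obtain ⟨B, hB⟩ : ∃ B : Matrix (Fin 3) (Fin 3) k, ∀ a, B.mulVec a = V a :=
    ⟨LinearMap.toMatrix' V, LinearMap.toMatrix'_mulVec V⟩
  let D : Polynomial k :=
    ((Polynomial.X : Polynomial k) • A.map Polynomial.C + (-B).map Polynomial.C).det
  have hDeval : ∀ t : k, D.eval t = (t • A - B).det := by
    intro t
    rw [← Polynomial.coe_evalRingHom, RingHom.map_det]
    congr 1
    ext i j
    simp [sub_eq_add_neg]
    ring
  have hker : ∀ t : k, (t • A - B).det = 0 ↔ ∃ a, a ≠ 0 ∧ t • U a - V a = 0 := by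
    intro t
    rw [← Matrix.exists_mulVec_eq_zero_iff]
    refine exists_congr fun a => ?_
    rw [Matrix.sub_mulVec, Matrix.smul_mulVec, hA, hB]
  have hsub : ∀ c d : k, (c, d) ≠ (0, 0) →
      {P : Projectivization k (Fin 3 → k) | c • U P.rep + d • V P.rep = 0}.Subsingleton := by
    intro c d hcd P hP P' hP'
    have := H.not_linearIndependent_pair hcd hP hP'
    rw [← P.mk_rep, ← P'.mk_rep, Projectivization.mk_eq_mk_iff']
    rw [LinearIndependent.pair_symm_iff, LinearIndependent.pair_iff' P'.rep_nonzero] at this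
    push Not at this
    exact this
  have hD : D = 0 := by
    classical
    by_contra hD
    apply hinf
    apply Set.Finite.subset (s := {P : Projectivization k (Fin 3 → k) |
        (1 : k) • U P.rep + (0 : k) • V P.rep = 0} ∪ ⋃ t ∈ D.roots.toFinset,
        {P : Projectivization k (Fin 3 → k) | t • U P.rep + (-1 : k) • V P.rep = 0})
    · refine (hsub 1 0 (by simp)).finite.union (Set.Finite.biUnion (Finset.finite_toSet _) ?_)
      intro t _
      exact (hsub t (-1) (by simp)).finite
    · rintro P ⟨α, β, v, hU, hV⟩
      by_cases hα : α = 0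
      · left
        simp [hU, hα]
      · right
        have hz : (β / α) • U P.rep - V P.rep = 0 := by
          rw [hU, hV, smul_smul, div_mul_cancel₀ _ hα, sub_self]
        simp only [Set.mem_iUnion]
        refine ⟨β / α, ?_, ?_⟩
        · rw [Multiset.mem_toFinset, Polynomial.mem_roots hD, Polynomial.IsRoot, hDeval, hker]
          exact ⟨P.rep, P.rep_nonzero, hz⟩
        · simpa [sub_eq_add_neg] using hz
  by_cases hα : α = 0
  · have hβ : β ≠ 0 := by
      rintro rfl
      simp [hα] at hαβ
    have hA0 : A.det = 0 := by
      rw [← Polynomial.coeff_det_X_add_C_card A (-B)]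
      change D.coeff _ = 0
      simp [hD]
    obtain ⟨a, ha, h⟩ := Matrix.exists_mulVec_eq_zero_iff.mpr hA0
    refine ⟨a, β⁻¹ • V a, ha, ?_, by simp [smul_smul, hβ]⟩
    rw [hα, zero_smul, ← hA, h]
  · obtain ⟨a, ha, h⟩ := (hker (β / α)).mp (by rw [← hDeval, hD, Polynomial.eval_zero])
    refine ⟨a, α⁻¹ • U a, ha, by simp [smul_smul, hα], ?_⟩
    rw [← sub_eq_zero.mp h, smul_smul, div_eq_mul_inv]

end LinearAlgebra

section Polynomials

variable {k : Type*} [Field k]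

/-- The binary quadratic form in `x, y` with coefficient vector `v`, as a polynomial. -/
def quadForm : (Fin 3 → k) →ₗ[k] Rk k :=
  Fintype.linearCombination k ![X 0 ^ 2, X 0 * X 1, X 1 ^ 2]

lemma quadForm_apply (v : Fin 3 → k) :
    quadForm v = C (v 0) * X 0 ^ 2 + C (v 1) * (X 0 * X 1) + C (v 2) * X 1 ^ 2 := by
  simp [quadForm, Fintype.linearCombination_apply, Fin.sum_univ_three, smul_eq_C_mul]

lemma eval_quadForm (v : Fin 3 → k) (x y z w : k) :
    eval ![x, y, z, w] (quadForm v) = quadEval x y v := by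
  simp [quadForm_apply, quadEval_apply]

lemma bihom_quadForm (v : Fin 3 → k) : Bihom (quadForm v) 2 0 := by
  have hx : ∀ i, (X i : Rk k).IsWeightedHomogeneous bidegWt (bidegWt i) :=
    fun i => isWeightedHomogeneous_X k bidegWt i
  have hC : ∀ a : k, (C a : Rk k).IsWeightedHomogeneous bidegWt 0 :=
    fun a => isWeightedHomogeneous_C bidegWt a
  rw [Bihom, quadForm_apply]
  refine ((?_ : IsWeightedHomogeneous _ _ _).add ?_).add ?_
  · convert! (hC (v 0)).mul ((hx 0).pow 2) using 1
  · convert! (hC (v 1)).mul ((hx 0).mul (hx 1)) using 1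
  · convert! (hC (v 2)).mul ((hx 1).pow 2) using 1

lemma Bihom.degrees {p : Rk k} {m n : ℤ} (hp : Bihom p m n) {d : Fin 4 →₀ ℕ}
    (hd : d ∈ p.support) : (d 0 + d 1 : ℤ) = m ∧ (d 2 + d 3 : ℤ) = n := by
  have h := hp (mem_support_iff.mp hd)
  rw [Finsupp.weight_apply, Finsupp.sum_fintype _ _ (by simp)] at h
  simpa [Fin.sum_univ_four, bidegWt, Prod.ext_iff] using h

lemma monomial_eq_C_mul (d : Fin 4 →₀ ℕ) (c : k) :
    monomial d c = C c * (X 0 ^ d 0 * X 1 ^ d 1 * X 2 ^ d 2 * X 3 ^ d 3) := by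
  rw [monomial_eq, Finsupp.prod_fintype _ _ (by simp), Fin.prod_univ_four]

lemma exists_quadForm_monomial (a b : ℕ) (hab : a + b = 2) (c : k) :
    ∃ v : Fin 3 → k, quadForm v = C c * (X 0 ^ a * X 1 ^ b) := by
  obtain rfl : b = 2 - a := by omega
  have : a ≤ 2 := by omega
  interval_cases a
  · exact ⟨![0, 0, c], by simp [quadForm_apply]⟩
  · exact ⟨![0, c, 0], by simp [quadForm_apply]⟩
  · exact ⟨![c, 0, 0], by simp [quadForm_apply]⟩

lemma Bihom.exists_eq_quadForm {q : Rk k} (hq : Bihom q 2 0) : ∃ v, q = quadForm v := by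
  rw [← support_sum_monomial_coeff q]
  refine Finset.sum_induction _ (fun p : Rk k => ∃ v, p = quadForm v) ?_ ⟨0, by simp⟩ ?_
  · rintro _ _ ⟨v, rfl⟩ ⟨v', rfl⟩
    exact ⟨v + v', by simp⟩
  · intro d hd
    obtain ⟨h1, h2⟩ := hq.degrees hd
    obtain ⟨v, hv⟩ := exists_quadForm_monomial (d 0) (d 1) (by omega) (coeff d q)
    refine ⟨v, ?_⟩
    rw [hv, monomial_eq_C_mul, show d 2 = 0 by omega, show d 3 = 0 by omega]
    ring

lemma Bihom.exists_eq_linearForm {l : Rk k} (hl : Bihom l 0 1) :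
    ∃ α β : k, l = C α * X 2 + C β * X 3 := by
  rw [← support_sum_monomial_coeff l]
  refine Finset.sum_induction _ (fun p : Rk k => ∃ α β : k, p = C α * X 2 + C β * X 3) ?_
    ⟨0, 0, by simp⟩ ?_
  · rintro _ _ ⟨α, β, rfl⟩ ⟨α', β', rfl⟩
    exact ⟨α + α', β + β', by simp only [map_add]; ring⟩
  · intro d hd
    obtain ⟨h1, h2⟩ := hl.degrees hd
    rw [monomial_eq_C_mul, show d 0 = 0 by omega, show d 1 = 0 by omega]
    obtain ⟨h, h'⟩ | ⟨h, h'⟩ : (d 2 = 1 ∧ d 3 = 0) ∨ (d 2 = 0 ∧ d 3 = 1) := by omega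
    · exact ⟨coeff d l, 0, by simp [h, h']⟩
    · exact ⟨0, coeff d l, by simp [h, h']⟩

lemma Bihom.exists_eq_quadForm_mul_add {p : Rk k} (hp : Bihom p 2 1) :
    ∃ u v, p = quadForm u * X 2 + quadForm v * X 3 := by
  rw [← support_sum_monomial_coeff p]
  refine Finset.sum_induction _
    (fun p : Rk k => ∃ u v, p = quadForm u * X 2 + quadForm v * X 3) ?_ ⟨0, 0, by simp⟩ ?_
  · rintro _ _ ⟨u, v, rfl⟩ ⟨u', v', rfl⟩
    exact ⟨u + u', v + v', by simp only [map_add]; ring⟩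
  · intro d hd
    obtain ⟨h1, h2⟩ := hp.degrees hd
    obtain ⟨v, hv⟩ := exists_quadForm_monomial (d 0) (d 1) (by omega) (coeff d p)
    rw [monomial_eq_C_mul]
    obtain ⟨h, h'⟩ | ⟨h, h'⟩ : (d 2 = 1 ∧ d 3 = 0) ∨ (d 2 = 0 ∧ d 3 = 1) := by omega
    · exact ⟨v, 0, by rw [hv, h, h', map_zero quadForm]; ring⟩
    · exact ⟨0, v, by rw [hv, h, h', map_zero quadForm]; ring⟩

lemma quadForm_mul_add_injective {u v u' v' : Fin 3 → k}
    (h : (quadForm u * X 2 + quadForm v * X 3 : Rk k) = quadForm u' * X 2 + quadForm v' * X 3) :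
    u = u' ∧ v = v' := by
  have key : ∀ x y z w : k, quadEval x y u * z + quadEval x y v * w
      = quadEval x y u' * z + quadEval x y v' * w := by
    intro x y z w
    simpa [eval_quadForm] using congrArg (eval ![x, y, z, w]) h
  exact ⟨quadEval_injective fun x y => by simpa using key x y 1 0,
    quadEval_injective fun x y => by simpa using key x y 0 1⟩

lemma irreducible_of_isHomogeneous_one {σ : Type*} {p : MvPolynomial σ k} (hp : p.IsHomogeneous 1)
    (h0 : p ≠ 0) : Irreducible p := by
  refine irreducible_of_totalDegree_eq_one (hp.totalDegree h0) fun x hx => ?_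
  obtain ⟨d, hd⟩ := ne_zero_iff.mp h0
  refine isUnit_iff_ne_zero.mpr ?_
  rintro rfl
  exact hd (zero_dvd_iff.mp (hx d))

lemma isRelPrime_of_isHomogeneous_one {σ : Type*} {p f : MvPolynomial σ k}
    (hp : p.IsHomogeneous 1) (h0 : p ≠ 0) {P : σ → k} (hpP : eval P p = 0) (hfP : eval P f ≠ 0) :
    IsRelPrime p f := by
  rw [(irreducible_of_isHomogeneous_one hp h0).isRelPrime_iff_not_dvd]
  rintro ⟨g, rfl⟩
  simp [hpP] at hfP

/-- Two relatively prime elements generating a proper ideal form a regular sequence. -/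
lemma isRegular_pair_of_isRelPrime {R : Type*} [CommRing R] [IsDomain R] [DecompositionMonoid R]
    {f g : R} (hf : f ≠ 0) (hfg : IsRelPrime f g) (htop : Ideal.span {f, g} ≠ ⊤) :
    RingTheory.Sequence.IsRegular R [f, g] := by
  rw [RingTheory.Sequence.isRegular_iff]
  constructor
  · rw [RingTheory.Sequence.isWeaklyRegular_iff]
    intro i hi
    rw [isSMulRegular_quotient_iff_mem_of_smul_mem]
    intro x hx
    match i, hi with
    | 0, _ => simpa [hf] using hx
    | 1, _ =>
      simp only [List.take_succ_cons, List.take_zero, Ideal.ofList_singleton, smul_eq_mul,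
        Ideal.mul_top, Ideal.mem_span_singleton, List.getElem_cons_succ,
        List.getElem_cons_zero] at hx ⊢
      exact hfg.dvd_of_dvd_mul_left hx
  · simpa [Ideal.span_insert] using htop.symm

lemma isHomogeneous_C_mul_X_add (a b : k) (i j : Fin 4) :
    (C a * X i + C b * X j : Rk k).IsHomogeneous 1 :=
  (isHomogeneous_C_mul_X a i).add (isHomogeneous_C_mul_X b j)

lemma exists_quadForm_eq_mul {v : Fin 3 → k} {a b : k} (hab : (a, b) ≠ (0, 0))
    (h : quadEval a b v = 0) : ∃ c d : k,
      quadForm v = (C b * X 0 + C (-a) * X 1) * (C c * X 0 + C d * X 1) := by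
  rw [quadEval_apply] at h
  have key : ∀ c d : k, v 0 = b * c → v 1 = b * d - a * c → v 2 = - (a * d) →
      quadForm v = (C b * X 0 + C (-a) * X 1) * (C c * X 0 + C d * X 1) := by
    intro c d h0 h1 h2
    rw [quadForm_apply, h0, h1, h2]
    simp only [map_sub, map_mul, map_neg]
    ring
  by_cases hb : b = 0
  · have ha : a ≠ 0 := by
      rintro rfl
      simp [hb] at hab
    have hv : v 0 = 0 := by simpa [hb, ha] using h
    refine ⟨-v 1 / a, -v 2 / a, key _ _ ?_ ?_ ?_⟩
    · simp [hb, hv]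
    · field_simp
      simp [hb]
    · field_simp
  · refine ⟨v 0 / b, (v 1 + a * (v 0 / b)) / b, key _ _ ?_ ?_ ?_⟩
    · field_simp
    · field_simp
      ring
    · field_simp
      linear_combination h

/-- A linear form in `x, y` is prime to a form `f` not vanishing at any zero of the linear form. -/
lemma isRelPrime_linear_left {c d : k} {f : Rk k} (h0 : (C c * X 0 + C d * X 1 : Rk k) ≠ 0)
    {z w : k} (hf : ∀ x y : k, (x, y) ≠ (0, 0) → c * x + d * y = 0 → eval ![x, y, z, w] f ≠ 0) :
    IsRelPrime (C c * X 0 + C d * X 1) f := by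
  refine isRelPrime_of_isHomogeneous_one (isHomogeneous_C_mul_X_add c d 0 1) h0
    (P := ![-d, c, z, w]) (by simp; ring) (hf _ _ ?_ (by ring))
  rintro h
  simp only [Prod.mk.injEq, neg_eq_zero] at h
  simp [h] at h0

/-- A binary quadratic form is prime to a form `f` not vanishing at any of its zeros. -/
lemma isRelPrime_quadForm_left [IsAlgClosed k] {v : Fin 3 → k} {f : Rk k} (hv : quadForm v ≠ 0)
    {z w : k} (hf : ∀ x y : k, (x, y) ≠ (0, 0) → quadEval x y v = 0 →
      eval ![x, y, z, w] f ≠ 0) :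
    IsRelPrime (quadForm v) f := by
  obtain ⟨a, b, hab, h⟩ := exists_quadEval_eq_zero v
  obtain ⟨c, d, hcd⟩ := exists_quadForm_eq_mul hab h
  have hev : ∀ x y : k, quadEval x y v = (b * x + -a * y) * (c * x + d * y) := by
    intro x y
    rw [← eval_quadForm v x y 0 0, hcd]
    simp
  rw [hcd] at hv ⊢
  refine IsRelPrime.mul_left
    (isRelPrime_linear_left (left_ne_zero_of_mul hv) (z := z) (w := w) ?_)
    (isRelPrime_linear_left (right_ne_zero_of_mul hv) (z := z) (w := w) ?_)
  · exact fun x y hxy h => hf x y hxy (by rw [hev, h, zero_mul])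
  · exact fun x y hxy h => hf x y hxy (by rw [hev, h, mul_zero])

lemma isRelPrime_X_left {i : Fin 4} {f : Rk k} {P : Fin 4 → k} (hP : P i = 0)
    (hf : eval P f ≠ 0) : IsRelPrime (X i) f :=
  isRelPrime_of_isHomogeneous_one (isHomogeneous_X k i) (X_ne_zero i) (by simpa) hf

end Polynomials

/-- **Lemma 6.6.** In the non-generic case there are `g0, g1 ∈ R_{2,0}` with no
common zero in `k² ∖ {0}` such that `span_k {p0, p1, p2} = span_k {g0 z, g1 w, (g0+g1)(z+w)}`;
moreover `g0, g1` and `g0 z, g1 w` are regular sequences in `R`. -/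
theorem statement12 {k : Type*} [Field k] [IsAlgClosed k] (p0 p1 p2 : Rk k)
    (h0 : Bihom p0 2 1) (h1 : Bihom p1 2 1) (h2 : Bihom p2 2 1)
    (hncz : NoCommonZeros p0 p1 p2) (hgen : ¬ BidegGeneric p0 p1 p2) :
    ∃ g0 g1 : Rk k, Bihom g0 2 0 ∧ Bihom g1 2 0 ∧
      (∀ a b : k, (a, b) ≠ ((0 : k), (0 : k)) →
        eval ![a, b, 0, 0] g0 ≠ 0 ∨ eval ![a, b, 0, 0] g1 ≠ 0) ∧
      Submodule.span k ({p0, p1, p2} : Set (Rk k))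
        = Submodule.span k ({g0 * X 2, g1 * X 3, (g0 + g1) * (X 2 + X 3)} : Set (Rk k)) ∧
      RingTheory.Sequence.IsRegular (Rk k) [g0, g1] ∧
      RingTheory.Sequence.IsRegular (Rk k) [g0 * X 2, g1 * X 3] := by
  obtain ⟨u0, v0, e0⟩ := h0.exists_eq_quadForm_mul_add
  obtain ⟨u1, v1, e1⟩ := h1.exists_eq_quadForm_mul_add
  obtain ⟨u2, v2, e2⟩ := h2.exists_eq_quadForm_mul_add
  let U := Fintype.linearCombination k ![u0, u1, u2]
  let V := Fintype.linearCombination k ![v0, v1, v2]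
  let φ := Fintype.linearCombination k ![p0, p1, p2]
  have hφ : ∀ a, φ a = a 0 • p0 + a 1 • p1 + a 2 • p2 := by
    intro a
    simp [φ, Fintype.linearCombination_apply, Fin.sum_univ_three]
  have hφUV : ∀ a, φ a = quadForm (U a) * X 2 + quadForm (V a) * X 3 := by
    intro a
    rw [hφ, e0, e1, e2]
    simp only [U, V, Fintype.linearCombination_apply, Fin.sum_univ_three, Matrix.cons_val, map_add,
      map_smul, smul_eq_C_mul]
    ring
  have hspan : Submodule.span k {p0, p1, p2} = LinearMap.range φ := by
    rw [Fintype.range_linearCombination, range_vecCons_three]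
  have H : BasePointFree U V := by
    intro x y c d hxy hcd
    have key : ∀ a, c * quadEval x y (U a) + d * quadEval x y (V a) = eval ![x, y, c, d] (φ a) := by
      intro a
      simp [hφUV, eval_quadForm, mul_comm]
    simp only [key, hφ]
    rcases hncz x y c d hxy hcd with h | h | h
    · exact ⟨![1, 0, 0], by simpa using h⟩
    · exact ⟨![0, 1, 0], by simpa using h⟩
    · exact ⟨![0, 0, 1], by simpa using h⟩
  obtain ⟨b, w0, w1, hb, hU0, hV0, hU1, hV1, hU2, hV2⟩ :=
      H.exists_normal_form <| H.exists_of_infinite <| by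
    refine Set.Infinite.mono ?_ hgen
    rintro P ⟨q, l, hq, hl, h⟩
    obtain ⟨v, rfl⟩ := hq.exists_eq_quadForm
    obtain ⟨α, β, rfl⟩ := hl.exists_eq_linearForm
    refine ⟨α, β, v, quadForm_mul_add_injective ?_⟩
    rw [← hφUV, hφ, h]
    simp only [map_smul, smul_eq_C_mul]
    ring
  have hspan' : Submodule.span k {p0, p1, p2} = Submodule.span k
      {quadForm w0 * X 2, quadForm w1 * X 3,
        (quadForm w0 + quadForm w1) * (X 2 + X 3 : Rk k)} := by
    rw [hspan, LinearMap.range_eq_map, ← hb.span_eq_top_of_card_eq_finrank' (by simp),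
      Submodule.map_span, ← Set.range_comp]
    have : φ ∘ b = ![quadForm w0 * X 2, quadForm w1 * X 3,
        (quadForm w0 + quadForm w1) * (X 2 + X 3 : Rk k)] := by
      ext1 i
      fin_cases i
      · simp [hφUV, hU0, hV0]
      · simp [hφUV, hU1, hV1]
      · simp [hφUV, hU2, hV2, mul_add]
    rw [this, range_vecCons_three]
  have hw : ∀ x y : k, (x, y) ≠ (0, 0) → quadEval x y w0 ≠ 0 ∨ quadEval x y w1 ≠ 0 := by
    intro x y hxy
    by_contra! hzero
    have hle : Submodule.span k {p0, p1, p2} ≤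
        LinearMap.ker (aeval ![x, y, 1, 0] : Rk k →ₐ[k] k).toLinearMap := by
      rw [hspan', Submodule.span_le]
      rintro _ (rfl | rfl | rfl) <;>
        simp [aeval_eq_eval, eval_quadForm, hzero]
    have hmem : ∀ p ∈ ({p0, p1, p2} : Set (Rk k)), eval ![x, y, 1, 0] p = 0 := fun p hp => by
      simpa [aeval_eq_eval] using hle (Submodule.subset_span hp)
    rcases hncz x y 1 0 hxy (by simp) with h | h | h
    · exact h (hmem _ (by simp))
    · exact h (hmem _ (by simp))
    · exact h (hmem _ (by simp))
  have hne : ∀ {v v' : Fin 3 → k}, (∀ x y : k, (x, y) ≠ (0, 0) → quadEval x y v ≠ 0 ∨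
      quadEval x y v' ≠ 0) → quadForm v ≠ 0 := by
    intro v v' h hv
    obtain ⟨x, y, hxy, hv'⟩ := exists_quadEval_eq_zero v'
    rcases h x y hxy with h | h
    · apply h
      rw [← eval_quadForm v x y 0 0, hv, map_zero]
    · exact h hv'
  have hw0 : quadForm w0 ≠ 0 := hne hw
  have hw1 : quadForm w1 ≠ 0 := hne fun x y hxy => (hw x y hxy).symm
  have hproper : ∀ f g : Rk k, eval 0 f = 0 → eval 0 g = 0 → Ideal.span {f, g} ≠ ⊤ := by
    intro f g hf hg htop
    have hle : Ideal.span {f, g} ≤ RingHom.ker (eval (0 : Fin 4 → k)) := by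
      rw [Ideal.span_le]
      rintro _ (rfl | rfl) <;> assumption
    rw [htop, top_le_iff] at hle
    exact RingHom.ker_ne_top _ hle
  have hq0 : ∀ v : Fin 3 → k, eval 0 (quadForm v) = 0 := by
    intro v
    simp [quadForm_apply]
  have hrel : IsRelPrime (quadForm w0) (quadForm w1) := by
    refine isRelPrime_quadForm_left hw0 (z := 0) (w := 0) fun x y hxy h => ?_
    rw [eval_quadForm]
    exact (hw x y hxy).resolve_left (not_not_intro h)
  have hrelw : IsRelPrime (quadForm w0) (X 3) :=
    isRelPrime_quadForm_left hw0 (z := 0) (w := 1) (by simp)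
  have hrelz : IsRelPrime (X 2) (quadForm w1) := by
    obtain ⟨x, y, hxy, h⟩ := exists_quadEval_eq_zero w0
    refine isRelPrime_X_left (P := ![x, y, 0, 0]) (by simp) ?_
    rw [eval_quadForm]
    exact (hw x y hxy).resolve_left (not_not_intro h)
  have hrelzw : IsRelPrime (X 2 : Rk k) (X 3) :=
    isRelPrime_X_left (P := ![0, 0, 0, 1]) (by simp) (by simp)
  refine ⟨quadForm w0, quadForm w1, bihom_quadForm w0, bihom_quadForm w1, ?_, hspan',
    isRegular_pair_of_isRelPrime hw0 hrel (hproper _ _ (hq0 _) (hq0 _)),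
    isRegular_pair_of_isRelPrime (mul_ne_zero hw0 (X_ne_zero 2)) ?_
      (hproper _ _ (by simp) (by simp))⟩
  · simpa only [eval_quadForm] using hw
  · exact (hrel.mul_right hrelw).mul_left (hrelz.mul_right hrelzw)
end
end

section
/- Let p0, p1, p2 ∈ R_{2,1} have no common zeros on P^1 × P^1. Then there exist a0, a1, a2 ∈ k, not all zero, such that a0 p0 + a1 p1 + a2 p2 cannot be written in the form q·l with q ∈ R_{2,0} and l ∈ R_{0,1}. (Equivalently, the plane spanned by p0, p1, p2 in P(R_{2,1}) is not contained in the Segre variety of products R_{2,0} · R_{0,1}.) -/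
open MvPolynomial

noncomputable section

/-- Two linear families of functions that are proportional at every parameter either satisfy a
common linear relation or are all multiples of a single member of the first family. -/
theorem common_relation_or_common_span {k E X : Type*} [Field k] [AddCommGroup E] [Module k E]
    (u v : E →ₗ[k] (X → k)) (huv : ∀ a P Q, u a P * v a Q = u a Q * v a P) :
    (∃ c d : k, (c, d) ≠ (0, 0) ∧ ∀ a P, c * u a P + d * v a P = 0) ∨
      ∃ a, ∀ b P, u a P = 0 → u b P = 0 ∧ v b P = 0 := by
  by_cases hu : ∀ a P, u a P = 0
  · exact Or.inl ⟨1, 0, by simp, by simp [hu]⟩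
  push Not at hu
  obtain ⟨a, P₀, ha⟩ := hu
  set t : k := v a P₀ / u a P₀ with ht
  have hva : ∀ P, v a P = t * u a P := fun P => by
    rw [ht]
    field_simp
    linear_combination huv a P₀ P
  have hwedge : ∀ b P Q,
      u a P * (v b Q - t * u b Q) = u a Q * (v b P - t * u b P) := fun b P Q => by
    have h := huv (a + b) P Q
    simp only [map_add, Pi.add_apply, hva] at h
    linear_combination h - huv b P Q
  by_cases hw : ∀ b P, v b P - t * u b P = 0
  · exact Or.inl ⟨-t, 1, by simp, fun b P => by linear_combination hw b P⟩
  push Not at hw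
  obtain ⟨b, Q₀, hb⟩ := hw
  have hab : u a Q₀ ≠ 0 := fun h => hb <| by
    have h' := hwedge b P₀ Q₀
    rw [h, zero_mul] at h'
    exact (mul_eq_zero.mp h').resolve_left ha
  refine Or.inr ⟨a, fun c P hP => ?_⟩
  have hv : ∀ c, v c P - t * u c P = 0 := fun c => by
    have h' := hwedge c P Q₀
    rw [hP, zero_mul] at h'
    exact (mul_eq_zero.mp h'.symm).resolve_left hab
  have hmul : ∀ c, u c P * (v c Q₀ - t * u c Q₀) = 0 := fun c => by
    linear_combination huv c P Q₀ + u c Q₀ * hv c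
  have hub : u b P = 0 := (mul_eq_zero.mp (hmul b)).resolve_right hb
  have huc : u c P = 0 := by
    have h := hmul (b + c)
    simp only [map_add, Pi.add_apply, hub, zero_add] at h
    have h' : u c P * (v b Q₀ - t * u b Q₀) = 0 := by linear_combination h - hmul c
    exact (mul_eq_zero.mp h').resolve_right hb
  exact ⟨huc, by simpa [huc] using hv c⟩

/-- A binary quadratic form over an algebraically closed field has a nontrivial zero. -/
theorem exists_zero_binary_quadratic {k : Type*} [Field k] [IsAlgClosed k] (A B C : k) :
    ∃ x y : k, (x, y) ≠ (0, 0) ∧ A * x ^ 2 + B * (x * y) + C * y ^ 2 = 0 := by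
  by_cases hA : A = 0
  · exact ⟨1, 0, by simp, by simp [hA]⟩
  obtain ⟨r, hr⟩ := IsAlgClosed.exists_root
    (Polynomial.C A * Polynomial.X ^ 2 + Polynomial.C B * Polynomial.X + Polynomial.C C)
    (by rw [Polynomial.degree_quadratic hA]; decide)
  exact ⟨r, 1, by simp, by simpa [Polynomial.IsRoot] using hr⟩

namespace Bihom

variable {k : Type*} [Field k]

theorem induction {p : Rk k} {m n : ℕ} (hp : Bihom p m n) {S : Rk k → Prop} (zero : S 0)
    (add : ∀ p q, S p → S q → S (p + q))
    (mon : ∀ (d : Fin 4 →₀ ℕ) (c : k), d 0 + d 1 = m → d 2 + d 3 = n → S (monomial d c)) :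
    S p := by
  rw [p.as_sum]
  refine Finset.sum_induction _ S add zero fun d hd => ?_
  have h := hp (mem_support_iff.mp hd)
  simp only [Finsupp.weight_apply, Finsupp.sum_fintype, zero_smul, implies_true,
    Fin.sum_univ_four, bidegWt, Prod.ext_iff] at h
  simp at h
  exact mon d _ (by omega) (by omega)

theorem exists_eval_eq_of_two_one {p : Rk k} (hp : Bihom p 2 1) :
    ∃ A B C A' B' C' : k, ∀ x y z w, eval ![x, y, z, w] p =
      (A * x ^ 2 + B * (x * y) + C * y ^ 2) * z +
        (A' * x ^ 2 + B' * (x * y) + C' * y ^ 2) * w := by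
  refine induction (m := 2) (n := 1) hp (S := fun p => ∃ A B C A' B' C' : k, ∀ x y z w,
      eval ![x, y, z, w] p = (A * x ^ 2 + B * (x * y) + C * y ^ 2) * z +
        (A' * x ^ 2 + B' * (x * y) + C' * y ^ 2) * w) ⟨0, 0, 0, 0, 0, 0, by simp⟩ ?_ ?_
  · rintro p q ⟨A, B, C, A', B', C', h⟩ ⟨D, E, F, D', E', F', h'⟩
    refine ⟨A + D, B + E, C + F, A' + D', B' + E', C' + F', fun x y z w => ?_⟩
    rw [map_add, h, h']
    ring
  · intro d c h01 h23
    have hd : d 0 = 2 ∧ d 1 = 0 ∨ d 0 = 1 ∧ d 1 = 1 ∨ d 0 = 0 ∧ d 1 = 2 := by omega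
    have hd' : d 2 = 1 ∧ d 3 = 0 ∨ d 2 = 0 ∧ d 3 = 1 := by omega
    simp only [eval_monomial, Finsupp.prod_fintype, pow_zero, implies_true, Fin.prod_univ_four]
    rcases hd' with ⟨e2, e3⟩ | ⟨e2, e3⟩
    · rcases hd with ⟨e0, e1⟩ | ⟨e0, e1⟩ | ⟨e0, e1⟩
      · exact ⟨c, 0, 0, 0, 0, 0, fun x y z w => by simp [e0, e1, e2, e3]; ring⟩
      · exact ⟨0, c, 0, 0, 0, 0, fun x y z w => by simp [e0, e1, e2, e3]; ring⟩
      · exact ⟨0, 0, c, 0, 0, 0, fun x y z w => by simp [e0, e1, e2, e3]; ring⟩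
    · rcases hd with ⟨e0, e1⟩ | ⟨e0, e1⟩ | ⟨e0, e1⟩
      · exact ⟨0, 0, 0, c, 0, 0, fun x y z w => by simp [e0, e1, e2, e3]; ring⟩
      · exact ⟨0, 0, 0, 0, c, 0, fun x y z w => by simp [e0, e1, e2, e3]; ring⟩
      · exact ⟨0, 0, 0, 0, 0, c, fun x y z w => by simp [e0, e1, e2, e3]; ring⟩

theorem eval_eq_of_snd_zero {q : Rk k} {m : ℕ} (hq : Bihom q m 0) (x y z w : k) :
    eval ![x, y, z, w] q = eval ![x, y, 0, 0] q := by
  refine induction (n := 0) hq (S := fun p => eval ![x, y, z, w] p = eval ![x, y, 0, 0] p) (by simp)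
    (fun p q h h' => by rw [map_add, map_add, h, h']) ?_
  intro d c _ h23
  have e2 : d 2 = 0 := by omega
  have e3 : d 3 = 0 := by omega
  simp [eval_monomial, Finsupp.prod_fintype, Fin.prod_univ_four, e2, e3]

theorem eval_eq_of_fst_zero {l : Rk k} {n : ℕ} (hl : Bihom l 0 n) (x y z w : k) :
    eval ![x, y, z, w] l = eval ![0, 0, z, w] l := by
  refine induction (m := 0) hl (S := fun p => eval ![x, y, z, w] p = eval ![0, 0, z, w] p) (by simp)
    (fun p q h h' => by rw [map_add, map_add, h, h']) ?_
  intro d c h01 _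
  have e0 : d 0 = 0 := by omega
  have e1 : d 1 = 0 := by omega
  simp [eval_monomial, Finsupp.prod_fintype, Fin.prod_univ_four, e0, e1]

end Bihom

/-- For a triple `p`, the linear family sending `a` to the function
`(x, y) ↦ ∑ i, a i * p i (x, y, z, w)`. -/
def evalFamily {k : Type*} [Field k] (p : Fin 3 → Rk k) (z w : k) :
    (Fin 3 → k) →ₗ[k] (k × k → k) :=
  Fintype.linearCombination k fun i P => eval ![P.1, P.2, z, w] (p i)

theorem evalFamily_apply {k : Type*} [Field k] (p : Fin 3 → Rk k) (z w : k) (a : Fin 3 → k)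
    (P : k × k) : evalFamily p z w a P =
      eval ![P.1, P.2, z, w] (a 0 • p 0 + a 1 • p 1 + a 2 • p 2) := by
  simp [evalFamily, Fintype.linearCombination_apply, Fin.sum_univ_three, smul_eval]

/-- Some nonzero linear combination of `p0, p1, p2` does not factor as
`q · l` with `q ∈ R_{2,0}` and `l ∈ R_{0,1}`. -/
theorem statement14 {k : Type*} [Field k] [IsAlgClosed k] (p0 p1 p2 : Rk k)
    (h0 : Bihom p0 2 1) (h1 : Bihom p1 2 1) (h2 : Bihom p2 2 1)
    (hncz : NoCommonZeros p0 p1 p2) :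
    ∃ a0 a1 a2 : k, ¬(a0 = 0 ∧ a1 = 0 ∧ a2 = 0) ∧
      ¬ ∃ q l : Rk k, Bihom q 2 0 ∧ Bihom l 0 1 ∧
          a0 • p0 + a1 • p1 + a2 • p2 = q * l := by
  by_contra! hcon
  obtain ⟨A₀, B₀, C₀, A₀', B₀', C₀', e0⟩ := h0.exists_eval_eq_of_two_one
  obtain ⟨A₁, B₁, C₁, A₁', B₁', C₁', e1⟩ := h1.exists_eval_eq_of_two_one
  obtain ⟨A₂, B₂, C₂, A₂', B₂', C₂', e2⟩ := h2.exists_eval_eq_of_two_one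
  set p : Fin 3 → Rk k := ![p0, p1, p2] with hp
  have happly : ∀ z w a P, evalFamily p z w a P = a 0 * eval ![P.1, P.2, z, w] p0 +
      a 1 * eval ![P.1, P.2, z, w] p1 + a 2 * eval ![P.1, P.2, z, w] p2 := fun z w a P => by
    simp [evalFamily_apply, hp, smul_eval]
  have hprop : ∀ a P Q, evalFamily p 1 0 a P * evalFamily p 0 1 a Q =
      evalFamily p 1 0 a Q * evalFamily p 0 1 a P := by
    intro a P Q
    by_cases ha : a 0 = 0 ∧ a 1 = 0 ∧ a 2 = 0
    · simp [evalFamily_apply, ha]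
    obtain ⟨q, l, hq, hl, h⟩ := hcon (a 0) (a 1) (a 2) (by tauto)
    replace h : a 0 • p 0 + a 1 • p 1 + a 2 • p 2 = q * l := h
    simp only [evalFamily_apply, h, map_mul]
    rw [hq.eval_eq_of_snd_zero (m := 2) P.1 P.2 1 0, hq.eval_eq_of_snd_zero (m := 2) P.1 P.2 0 1,
      hq.eval_eq_of_snd_zero (m := 2) Q.1 Q.2 1 0, hq.eval_eq_of_snd_zero (m := 2) Q.1 Q.2 0 1,
      hl.eval_eq_of_fst_zero (n := 1) P.1 P.2, hl.eval_eq_of_fst_zero (n := 1) P.1 P.2,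
      hl.eval_eq_of_fst_zero (n := 1) Q.1 Q.2, hl.eval_eq_of_fst_zero (n := 1) Q.1 Q.2]
    ring
  have hnot : ∀ x y z w : k, (x, y) ≠ (0, 0) → (z, w) ≠ (0, 0) →
      ¬ ∀ a, z * evalFamily p 1 0 a (x, y) + w * evalFamily p 0 1 a (x, y) = 0 := by
    intro x y z w hxy hzw h
    have i0 := h ![1, 0, 0]
    have i1 := h ![0, 1, 0]
    have i2 := h ![0, 0, 1]
    simp [happly, e0, e1, e2] at i0 i1 i2
    rcases hncz x y z w hxy hzw with h | h | h
    · exact h (by rw [e0]; linear_combination i0)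
    · exact h (by rw [e1]; linear_combination i1)
    · exact h (by rw [e2]; linear_combination i2)
  rcases common_relation_or_common_span _ _ hprop with ⟨c, d, hcd, h⟩ | ⟨a, h⟩
  · exact hnot 1 0 c d (by simp) hcd fun a => h a _
  · obtain ⟨x, y, hxy, hz⟩ := exists_zero_binary_quadratic (a 0 * A₀ + a 1 * A₁ + a 2 * A₂)
      (a 0 * B₀ + a 1 * B₁ + a 2 * B₂) (a 0 * C₀ + a 1 * C₁ + a 2 * C₂)
    refine hnot x y 1 0 hxy (by simp) fun b => ?_
    obtain ⟨hu, hv⟩ := h b (x, y) (by rw [happly, e0, e1, e2]; linear_combination hz)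
    rw [hu, hv]
    ring
end
end

section
/- Let g0, g1 ∈ R_{2,0} have no common zero in k^2 ∖ {(0,0)}. Then in R the ideal quotient (⟨g0 z, g1 w⟩ : (g0 + g1)(z + w)) equals the ideal ⟨z w, g0 z, g1 w, g0 g1⟩. -/
open MvPolynomial

noncomputable section

/-- The endomorphism of `R` that sets `z = w = 0`. -/
def killZW (k : Type*) [Field k] : Rk k →ₐ[k] Rk k :=
  aeval ![X 0, X 1, 0, 0]

lemma exists_eq_killZW_add {k : Type*} [Field k] (p : Rk k) :
    ∃ s t : Rk k, p = killZW k p + s * X 2 + t * X 3 := by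
  let I : Ideal (Rk k) := Ideal.span {X 2, X 3}
  have hmk : (Ideal.Quotient.mkₐ k I).comp (killZW k) = Ideal.Quotient.mkₐ k I := by
    ext i
    have h2 : Ideal.Quotient.mk I (X 2) = 0 :=
      Ideal.Quotient.eq_zero_iff_mem.mpr (Ideal.subset_span (by simp))
    have h3 : Ideal.Quotient.mk I (X 3) = 0 :=
      Ideal.Quotient.eq_zero_iff_mem.mpr (Ideal.subset_span (by simp))
    fin_cases i <;> simp [killZW, h2, h3]
  have hp : p - killZW k p ∈ I :=
    Ideal.Quotient.eq.mp (AlgHom.congr_fun hmk p).symm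
  obtain ⟨s, t, h⟩ := Ideal.mem_span_pair.mp hp
  exact ⟨s, t, by linear_combination -h⟩

lemma Bihom.killZW_eq {k : Type*} [Field k] {g : Rk k} {m : ℤ} (hg : Bihom g m 0) :
    killZW k g = g := by
  have key : ∀ i ∈ g.vars, (![X 0, X 1, 0, 0] : Fin 4 → Rk k) i = X i := by
    intro i hi
    obtain ⟨d, hd, hdi⟩ := (mem_vars_iff_mem_support i).mp hi
    have hw := hg (mem_support_iff.mp hd)
    rw [Finsupp.weight_apply, Finsupp.sum_fintype _ _ (by simp)] at hw
    simp only [Fin.sum_univ_four, bidegWt, Prod.ext_iff] at hw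
    simp at hw
    rw [Finsupp.mem_support_iff] at hdi
    fin_cases i <;> simp at hdi ⊢ <;> omega
  have := hom_congr_vars (f₁ := (killZW k : Rk k →+* Rk k)) (f₂ := RingHom.id _)
    (p₁ := g) (p₂ := g) (by ext; simp [killZW]) (fun i hi _ => by simpa [killZW] using key i hi) rfl
  simpa using this

lemma Bihom.eval_eq {k : Type*} [Field k] {g : Rk k} {m : ℤ} (hg : Bihom g m 0)
    (v : Fin 4 → k) : eval v g = eval ![v 0, v 1, 0, 0] g := by
  have h : (aeval v).comp (killZW k) = aeval ![v 0, v 1, 0, 0] := by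
    ext i
    fin_cases i <;> simp [killZW]
  have := AlgHom.congr_fun h g
  rwa [AlgHom.comp_apply, hg.killZW_eq] at this

lemma Bihom.not_isUnit {k : Type*} [Field k] {g : Rk k} {m n : ℤ} (hg : Bihom g m n)
    (hm : m ≠ 0) : ¬ IsUnit g := by
  intro hu
  have hc : coeff 0 g ≠ 0 := (hu.map (constantCoeff (σ := Fin 4) (R := k))).ne_zero
  have hw := hg hc
  rw [map_zero, Prod.ext_iff] at hw
  exact hm hw.1.symm

lemma isRelPrime_of_no_common_zero {k : Type*} [Field k] [IsAlgClosed k] {g0 g1 : Rk k} {m n : ℤ}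
    (hg0 : Bihom g0 m 0) (hg1 : Bihom g1 n 0)
    (hcz : ∀ a b : k, (a, b) ≠ ((0 : k), (0 : k)) →
      eval ![a, b, 0, 0] g0 ≠ 0 ∨ eval ![a, b, 0, 0] g1 ≠ 0) :
    IsRelPrime g0 g1 := by
  have hzero : ∀ v ∈ zeroLocus k (Ideal.span {g0, g1}), v 0 = 0 ∧ v 1 = 0 := by
    intro v hv
    have h0 : eval v g0 = 0 := hv g0 (Ideal.subset_span (by simp))
    have h1 : eval v g1 = 0 := hv g1 (Ideal.subset_span (by simp))
    rw [hg0.eval_eq] at h0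
    rw [hg1.eval_eq] at h1
    by_contra hne
    rcases hcz (v 0) (v 1) (by simpa using hne) with h | h
    exacts [h h0, h h1]
  have hX (i : Fin 4) (hi : ∀ v ∈ zeroLocus k (Ideal.span {g0, g1}), v i = 0) :
      ∃ N : ℕ, (X i : Rk k) ^ N ∈ Ideal.span {g0, g1} := by
    change X i ∈ (Ideal.span {g0, g1}).radical
    rw [← vanishingIdeal_zeroLocus_eq_radical (K := k)]
    intro v hv
    simpa using hi v hv
  obtain ⟨M, hM⟩ := hX 0 fun v hv => (hzero v hv).1
  obtain ⟨N, hN⟩ := hX 1 fun v hv => (hzero v hv).2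
  have hXY : IsRelPrime (X 0 : Rk k) (X 1) :=
    X_prime.irreducible.isRelPrime_iff_not_dvd.mpr (by simp [X_dvd_X])
  intro d hd0 hd1
  have hle : Ideal.span {g0, g1} ≤ Ideal.span {d} := by
    simp [Ideal.span_le, Set.insert_subset_iff, Ideal.mem_span_singleton, hd0, hd1]
  exact hXY.pow (Ideal.mem_span_singleton.mp (hle hM)) (Ideal.mem_span_singleton.mp (hle hN))

/-- If `(g0 + g1) * (z + w) * a` is a combination of `g0 * z` and `g1 * w`, with `g0`, `g1`
relatively prime and free of `z`, `w`, then `a` lies in the ideal `⟨zw, g0 z, g1 w, g0 g1⟩`. -/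
lemma mem_span_of_mul_eq {k : Type*} [Field k] {g0 g1 a b c : Rk k}
    (h0 : killZW k g0 = g0) (h1 : killZW k g1 = g1) (hg0 : g0 ≠ 0) (hg1 : g1 ≠ 0)
    (hrel : IsRelPrime g0 g1)
    (h : b * (g0 * X 2) + c * (g1 * X 3) = a * ((g0 + g1) * (X 2 + X 3))) :
    a ∈ Ideal.span ({X 2 * X 3, g0 * X 2, g1 * X 3, g0 * g1} : Set (Rk k)) := by
  have hz : killZW k (X 2) = 0 := by simp [killZW]
  have hw : killZW k (X 3) = 0 := by simp [killZW]
  have hz0 : (X 2 : Rk k) ≠ 0 := X_ne_zero _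
  have hzw : IsRelPrime (X 2 : Rk k) (X 3) :=
    X_prime.irreducible.isRelPrime_iff_not_dvd.mpr (by simp [X_dvd_X])
  have e1 : g0 * (a * X 3 - (b - a) * X 2) = g1 * ((c - a) * X 3 - a * X 2) := by
    linear_combination -h
  obtain ⟨d, hd⟩ : g0 ∣ (c - a) * X 3 - a * X 2 :=
    hrel.dvd_of_dvd_mul_left (Dvd.intro _ e1)
  have hd' : a * X 3 - (b - a) * X 2 = g1 * d :=
    mul_left_cancel₀ hg0 (by rw [e1, hd]; ring)
  have hπd : killZW k d = 0 := by
    have := congrArg (killZW k) hd'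
    simp only [map_sub, map_mul, hz, hw, h1, mul_zero, sub_zero] at this
    exact (mul_eq_zero.mp this.symm).resolve_left hg1
  obtain ⟨d1, d2, hd12⟩ := exists_eq_killZW_add d
  rw [hπd, zero_add] at hd12
  obtain ⟨e, he⟩ : X 2 ∣ a - g1 * d2 :=
    hzw.dvd_of_dvd_mul_left (Dvd.intro (b - a + g1 * d1)
      (by linear_combination -hd' - g1 * hd12))
  obtain ⟨e', he'⟩ : X 3 ∣ a + g0 * d1 :=
    hzw.symm.dvd_of_dvd_mul_left (Dvd.intro (c - a - g0 * d2)
      (by linear_combination hd + g0 * hd12))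
  have e2 : killZW k a = g1 * killZW k d2 := by
    have := congrArg (killZW k) he
    simp only [map_sub, map_mul, hz, h1, zero_mul] at this
    exact sub_eq_zero.mp this
  have e3 : killZW k a + g0 * killZW k d1 = 0 := by
    have := congrArg (killZW k) he'
    simpa only [map_add, map_mul, hw, h0, zero_mul] using this
  obtain ⟨q, hq⟩ : g0 ∣ killZW k d2 :=
    hrel.dvd_of_dvd_mul_left (Dvd.intro (-killZW k d1) (by linear_combination e2 - e3))
  have hq' : killZW k d1 = -(g1 * q) :=
    mul_left_cancel₀ hg0 (by linear_combination e3 - e2 - g1 * hq)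
  obtain ⟨t, s, hts⟩ := exists_eq_killZW_add d2
  obtain ⟨t', s', hts'⟩ := exists_eq_killZW_add d1
  rw [hq] at hts
  rw [hq'] at hts'
  obtain ⟨r, hr⟩ : X 3 ∣ e + g1 * t + g0 * t' :=
    hzw.symm.dvd_of_dvd_mul_left (Dvd.intro (e' - g0 * s' - g1 * s)
      (by linear_combination he - he' + g1 * hts + g0 * hts'))
  have ha : a = r * (X 2 * X 3) + -t' * (g0 * X 2) + s * (g1 * X 3) + q * (g0 * g1) := by
    linear_combination he + g1 * hts + X 2 * hr
  rw [ha]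
  refine add_mem (add_mem (add_mem ?_ ?_) ?_) ?_ <;>
    exact Ideal.mul_mem_left _ _ (Ideal.subset_span (by simp))

/-- If `g0, g1 ∈ R_{2,0}` have no common zero in `k² ∖ {0}`, then
`(⟨g0 z, g1 w⟩ : (g0 + g1)(z + w)) = ⟨zw, g0 z, g1 w, g0 g1⟩`. -/
theorem statement15 {k : Type*} [Field k] [IsAlgClosed k] (g0 g1 : Rk k)
    (hg0 : Bihom g0 2 0) (hg1 : Bihom g1 2 0)
    (hcz : ∀ a b : k, (a, b) ≠ ((0 : k), (0 : k)) →
      eval ![a, b, 0, 0] g0 ≠ 0 ∨ eval ![a, b, 0, 0] g1 ≠ 0) :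
    Submodule.colon (Ideal.span ({g0 * X 2, g1 * X 3} : Set (Rk k)))
        (Ideal.span ({(g0 + g1) * (X 2 + X 3)} : Set (Rk k)))
      = Ideal.span ({X 2 * X 3, g0 * X 2, g1 * X 3, g0 * g1} : Set (Rk k)) := by
  have hrel := isRelPrime_of_no_common_zero hg0 hg1 hcz
  have hne0 : g0 ≠ 0 := by
    rintro rfl
    exact hg1.not_isUnit two_ne_zero (isRelPrime_zero_left.mp hrel)
  have hne1 : g1 ≠ 0 := by
    rintro rfl
    exact hg0.not_isUnit two_ne_zero (isRelPrime_zero_right.mp hrel)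
  apply le_antisymm
  · intro a ha
    have hmem := Submodule.mem_colon.mp ha _ (Ideal.subset_span (Set.mem_singleton _))
    obtain ⟨b, c, h⟩ := Ideal.mem_span_pair.mp hmem
    exact mem_span_of_mul_eq hg0.killZW_eq hg1.killZW_eq hne0 hne1 hrel h
  · rw [Ideal.span_le]
    intro a ha
    refine Submodule.mem_colon.mpr fun p hp => ?_
    obtain ⟨q, rfl⟩ := Ideal.mem_span_singleton'.mp hp
    rw [Ideal.mem_span_pair]
    simp only [Set.mem_insert_iff, Set.mem_singleton_iff] at ha
    simp only [smul_eq_mul]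
    rcases ha with rfl | rfl | rfl | rfl
    · exact ⟨q * (X 3 * (X 2 + X 3)), q * (X 2 * (X 2 + X 3)), by ring⟩
    · exact ⟨q * ((g0 + g1) * (X 2 + X 3)), 0, by ring⟩
    · exact ⟨0, q * ((g0 + g1) * (X 2 + X 3)), by ring⟩
    · exact ⟨q * (g1 * (g0 + g1)), q * (g0 * (g0 + g1)), by ring⟩
end
end
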